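/- arXiv:1307.5537 — 2 statements merged into one kernel-verified Lean document; each statement's English description precedes it below -/
import Mathlib

section
/- Let N = 2 and let (u,v) be a solution of the system Δu = u v², Δv = v u², u > 0, v > 0 on ℝ² which is monotone, i.e. ∂u/∂x₂ > 0 and ∂v/∂x₂ < 0 everywhere on ℝ², and which has at most algebraic growth at infinity, i.e. there exist constants C > 0 and α ≥ 1 such that u(x) + v(x) ≤ C(1 + |x|)^α for all x ∈ ℝ². Then (u,v) is one dimensional: there exist functions U, V : ℝ → ℝ and a unit vector ν ∈ ℝ² such that u(x) = U(ν·x) and v(x) = V(ν·x) for every x ∈ ℝ². -/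
open MeasureTheory
open scoped RealInnerProductSpace

/-- The Laplacian of `f : ℝ² → ℝ`, as the sum of the second partial derivatives. -/
noncomputable def lapl (f : EuclideanSpace ℝ (Fin 2) → ℝ) (x : EuclideanSpace ℝ (Fin 2)) : ℝ :=
  ∑ i, fderiv ℝ (fun y => fderiv ℝ f y (EuclideanSpace.single i 1)) x (EuclideanSpace.single i 1)

/-- The plane. -/
abbrev Pl := EuclideanSpace ℝ (Fin 2)

/-- Derivative of `f` along the vector field `V`. -/
noncomputable def dv (V : Pl → Pl) (f : Pl → ℝ) (x : Pl) : ℝ := fderiv ℝ f x (V x)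

/-- Constant coordinate field. -/
noncomputable def ce (j : Fin 2) (_ : Pl) : Pl := EuclideanSpace.single j 1

notation:max "pd" j:max => dv (ce j)

/-- Rotation field. -/
noncomputable def Jf (x : Pl) : Pl := !₂[-x 1, x 0]

/-- Euler field. -/
def Ef (x : Pl) : Pl := x

notation "Rd" => dv Ef
notation "Td" => dv Jf

/-- Squared norm. -/
noncomputable def nsq (x : Pl) : ℝ := x 0 ^ 2 + x 1 ^ 2

lemma ce_contDiff (j : Fin 2) {n : WithTop ℕ∞} : ContDiff ℝ n (ce j) := contDiff_const

lemma coord_contDiff (j : Fin 2) {n : WithTop ℕ∞} : ContDiff ℝ n (fun x : Pl => x j) := by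
  fun_prop

lemma Jf_contDiff {n : WithTop ℕ∞} : ContDiff ℝ n Jf := by
  rw [contDiff_euclidean]
  intro i
  fin_cases i
  · simpa [Jf] using (coord_contDiff 1).neg
  · simpa [Jf] using (coord_contDiff 0)

lemma nsq_contDiff {n : WithTop ℕ∞} : ContDiff ℝ n nsq := by
  unfold nsq; fun_prop

section dvrules
variable {V : Pl → Pl} {f g : Pl → ℝ} {x : Pl}

lemma dv_add (hf : DifferentiableAt ℝ f x) (hg : DifferentiableAt ℝ g x) :
    dv V (fun y => f y + g y) x = dv V f x + dv V g x := by
  simp only [dv]; rw [fderiv_fun_add hf hg]; rfl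

lemma dv_sub (hf : DifferentiableAt ℝ f x) (hg : DifferentiableAt ℝ g x) :
    dv V (fun y => f y - g y) x = dv V f x - dv V g x := by
  simp only [dv]; rw [fderiv_fun_sub hf hg]; rfl

lemma dv_neg : dv V (fun y => - f y) x = - dv V f x := by
  simp only [dv]; rw [fderiv_fun_neg]; rfl

lemma dv_const (c : ℝ) : dv V (fun _ => c) x = 0 := by
  simp only [dv]; rw [fderiv_fun_const]; rfl

lemma dv_mul (hf : DifferentiableAt ℝ f x) (hg : DifferentiableAt ℝ g x) :
    dv V (fun y => f y * g y) x = f x * dv V g x + g x * dv V f x := by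
  simp only [dv]; rw [fderiv_fun_mul hf hg]; rfl

lemma dv_sq (hf : DifferentiableAt ℝ f x) :
    dv V (fun y => f y ^ 2) x = 2 * f x * dv V f x := by
  simp only [pow_two]; rw [dv_mul hf hf]; ring

lemma dv_div (hf : DifferentiableAt ℝ f x) (hg : DifferentiableAt ℝ g x) (h0 : g x ≠ 0) :
    dv V (fun y => f y / g y) x = (dv V f x - f x / g x * dv V g x) / g x := by
  have hd : DifferentiableAt ℝ (fun y => f y / g y) x := by
    simp only [div_eq_mul_inv]; exact hf.fun_mul (hg.fun_inv h0)
  have h := dv_mul (V := V) hd hg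
  have e : dv V (fun y => f y / g y * g y) x = dv V f x := by
    simp only [dv]
    congr 1
    apply Filter.EventuallyEq.fderiv_eq
    filter_upwards [hg.continuousAt.eventually_ne h0] with y hy
    field_simp
  rw [e] at h
  rw [h]; field_simp; ring

lemma dv_coord (j : Fin 2) : dv V (fun y : Pl => y j) x = V x j := by
  simp only [dv]
  have : HasFDerivAt (fun y : Pl => y j) (EuclideanSpace.proj j : Pl →L[ℝ] ℝ) x :=
    (EuclideanSpace.proj j : Pl →L[ℝ] ℝ).hasFDerivAt
  rw [this.fderiv]; rfl

lemma dv_eq : dv V f x = V x 0 * pd 0 f x + V x 1 * pd 1 f x := by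
  have : V x = V x 0 • (EuclideanSpace.single 0 1 : Pl) + V x 1 • (EuclideanSpace.single 1 1 : Pl) := by
    ext i; fin_cases i <;> simp
  simp only [dv, ce]
  conv_lhs => rw [this]
  rw [map_add, map_smul, map_smul]; rfl

lemma dv_contDiff {n m : WithTop ℕ∞} (hV : ContDiff ℝ n V) (hf : ContDiff ℝ m f) (h : n + 1 ≤ m) :
    ContDiff ℝ n (dv V f) := (hf.fderiv_right h).clm_apply hV

end dvrules

lemma Rd_eq (f : Pl → ℝ) (x : Pl) : Rd f x = x 0 * pd 0 f x + x 1 * pd 1 f x := dv_eq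
lemma Td_eq (f : Pl → ℝ) (x : Pl) : Td f x = -x 1 * pd 0 f x + x 0 * pd 1 f x := dv_eq

lemma pd_C1 {u : Pl → ℝ} (hu : ContDiff ℝ 2 u) (j : Fin 2) : ContDiff ℝ 1 (pd j u) :=
  dv_contDiff (ce_contDiff j) hu (by norm_num)
lemma Rd_C1 {u : Pl → ℝ} (hu : ContDiff ℝ 2 u) : ContDiff ℝ 1 (Rd u) :=
  dv_contDiff (V := Ef) contDiff_id hu (by norm_num)
lemma Td_C1 {u : Pl → ℝ} (hu : ContDiff ℝ 2 u) : ContDiff ℝ 1 (Td u) :=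
  dv_contDiff Jf_contDiff hu (by norm_num)
lemma pd_C0 {u : Pl → ℝ} (hu : ContDiff ℝ 1 u) (j : Fin 2) : Continuous (pd j u) :=
  (dv_contDiff (n := 0) (ce_contDiff j) hu (by norm_num)).continuous
lemma Rd_C0 {u : Pl → ℝ} (hu : ContDiff ℝ 1 u) : Continuous (Rd u) :=
  (dv_contDiff (V := Ef) (n := 0) contDiff_id hu (by norm_num)).continuous
lemma Td_C0 {u : Pl → ℝ} (hu : ContDiff ℝ 1 u) : Continuous (Td u) :=
  (dv_contDiff (n := 0) Jf_contDiff hu (by norm_num)).continuous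

lemma C1_diff {u : Pl → ℝ} (hu : ContDiff ℝ 1 u) (x : Pl) : DifferentiableAt ℝ u x :=
  hu.differentiable (by norm_num) x

lemma pd_comm {u : Pl → ℝ} (hu : ContDiff ℝ 2 u) (x : Pl) (i j : Fin 2) :
    pd i (pd j u) x = pd j (pd i u) x := by
  have hs : IsSymmSndFDerivAt ℝ u x := by
    apply hu.contDiffAt.isSymmSndFDerivAt; simp
  have key : ∀ i j, pd i (pd j u) x = fderiv ℝ (fderiv ℝ u) x (EuclideanSpace.single i 1)
      (EuclideanSpace.single j 1) := by
    intro i j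
    simp only [dv, ce]
    change fderiv ℝ (fun y => fderiv ℝ u y (EuclideanSpace.single j 1)) x _ = _
    have hd : DifferentiableAt ℝ (fderiv ℝ u) x :=
      (hu.fderiv_right (m := 1) (by norm_num)).differentiable (by norm_num) x
    rw [fderiv_clm_apply hd (differentiableAt_const _)]
    simp
  rw [key, key]; exact hs _ _

lemma lapl_eq (u : Pl → ℝ) (x : Pl) : lapl u x = pd 0 (pd 0 u) x + pd 1 (pd 1 u) x := by
  simp only [lapl, Fin.sum_univ_two]; rfl

lemma second_order {g : Pl → ℝ} (hg : ContDiff ℝ 2 g) (x : Pl) :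
    Rd (Td g) x = Td (Rd g) x ∧ Rd (Rd g) x + Td (Td g) x = nsq x * lapl g x := by
  have eR : Rd g = fun x => x 0 * pd 0 g x + x 1 * pd 1 g x := funext (Rd_eq g)
  have eT : Td g = fun x => -x 1 * pd 0 g x + x 0 * pd 1 g x := funext (Td_eq g)
  have c0 : DifferentiableAt ℝ (fun x : Pl => x 0) x := by fun_prop
  have c1 : DifferentiableAt ℝ (fun x : Pl => x 1) x := by fun_prop
  have p0 := C1_diff (pd_C1 hg 0) x
  have p1 := C1_diff (pd_C1 hg 1) x
  have hR : ∀ V, dv V (Rd g) x = x 0 * dv V (pd 0 g) x + pd 0 g x * V x 0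
      + (x 1 * dv V (pd 1 g) x + pd 1 g x * V x 1) := by
    intro V
    rw [eR, dv_add (c0.fun_mul p0) (c1.fun_mul p1), dv_mul c0 p0, dv_mul c1 p1, dv_coord, dv_coord]
  have hT : ∀ V, dv V (Td g) x = -x 1 * dv V (pd 0 g) x + pd 0 g x * (- V x 1)
      + (x 0 * dv V (pd 1 g) x + pd 1 g x * V x 0) := by
    intro V
    rw [eT, dv_add (c1.fun_neg.fun_mul p0) (c0.fun_mul p1), dv_mul c1.fun_neg p0, dv_mul c0 p1, dv_neg, dv_coord, dv_coord]
  have J0 : Jf x 0 = - x 1 := by simp [Jf]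
  have J1 : Jf x 1 = x 0 := by simp [Jf]
  have E0 : Ef x 0 = x 0 := rfl
  have E1 : Ef x 1 = x 1 := rfl
  have hc := pd_comm hg x 0 1
  constructor
  · rw [hR, hT, J0, J1, E0, E1, Td_eq, Td_eq, Rd_eq, Rd_eq, hc]; ring
  · rw [hR, hT, J0, J1, E0, E1, Td_eq, Td_eq, Rd_eq, Rd_eq, hc, lapl_eq, nsq]; ring

/-- Log-polar coordinates. -/
noncomputable def Pp (t θ : ℝ) : Pl := !₂[Real.exp t * Real.cos θ, Real.exp t * Real.sin θ]

/-- Circle integral. -/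
noncomputable def cI (F : Pl → ℝ) (t : ℝ) : ℝ := ∫ θ in (0:ℝ)..(2 * Real.pi), F (Pp t θ)

lemma Pp_cont : Continuous (fun p : ℝ × ℝ => Pp p.1 p.2) := by
  unfold Pp; fun_prop

lemma Pp_nsq (t θ : ℝ) : nsq (Pp t θ) = Real.exp (2 * t) := by
  simp only [nsq, Pp, two_mul, Real.exp_add]
  simp only [Matrix.cons_val_zero, Matrix.cons_val_one, Matrix.cons_val_fin_one]
  linear_combination Real.exp t ^ 2 * Real.sin_sq_add_cos_sq θ

lemma pl_eq (y : Pl) :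
    y = y 0 • (EuclideanSpace.single 0 1 : Pl) + y 1 • (EuclideanSpace.single 1 1 : Pl) := by
  ext i; fin_cases i <;> simp

lemma pl_deriv {f : ℝ → Pl} {y : Pl} {t : ℝ} (h : ∀ i, HasDerivAt (fun s => f s i) (y i) t) :
    HasDerivAt f y t := by
  have e : f = fun s => f s 0 • (EuclideanSpace.single 0 1 : Pl)
      + f s 1 • (EuclideanSpace.single 1 1 : Pl) := funext fun s => pl_eq (f s)
  rw [e, pl_eq y]
  exact ((h 0).smul_const _).fun_add ((h 1).smul_const _)

lemma Pp_dt (t θ : ℝ) : HasDerivAt (fun t => Pp t θ) (Ef (Pp t θ)) t := by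
  apply pl_deriv
  intro i
  fin_cases i
  · simpa [Pp, Ef] using (Real.hasDerivAt_exp t).mul_const (Real.cos θ)
  · simpa [Pp, Ef] using (Real.hasDerivAt_exp t).mul_const (Real.sin θ)

lemma Pp_dθ (t θ : ℝ) : HasDerivAt (fun θ => Pp t θ) (Jf (Pp t θ)) θ := by
  apply pl_deriv
  intro i
  fin_cases i
  · simpa [Pp, Jf] using (Real.hasDerivAt_cos θ).const_mul (Real.exp t)
  · simpa [Pp, Jf] using (Real.hasDerivAt_sin θ).const_mul (Real.exp t)

lemma comp_dt {F : Pl → ℝ} (hF : ContDiff ℝ 1 F) (t θ : ℝ) :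
    HasDerivAt (fun t => F (Pp t θ)) (Rd F (Pp t θ)) t :=
  (C1_diff hF (Pp t θ)).hasFDerivAt.comp_hasDerivAt t (Pp_dt t θ)

lemma comp_dθ {F : Pl → ℝ} (hF : ContDiff ℝ 1 F) (t θ : ℝ) :
    HasDerivAt (fun θ => F (Pp t θ)) (Td F (Pp t θ)) θ :=
  (C1_diff hF (Pp t θ)).hasFDerivAt.comp_hasDerivAt θ (Pp_dθ t θ)

lemma comp_cont2 {F : Pl → ℝ} (hF : Continuous F) : Continuous (fun p : ℝ × ℝ => F (Pp p.1 p.2)) :=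
  hF.comp Pp_cont

lemma comp_cont {F : Pl → ℝ} (hF : Continuous F) (t : ℝ) : Continuous (fun θ => F (Pp t θ)) :=
  (comp_cont2 hF).comp (Continuous.prodMk_right t)

lemma cI_cont {F : Pl → ℝ} (hF : Continuous F) : Continuous (cI F) :=
  intervalIntegral.continuous_parametric_intervalIntegral_of_continuous'
    (f := fun t θ => F (Pp t θ)) (comp_cont2 hF) _ _

lemma cI_ii {F : Pl → ℝ} (hF : Continuous F) (t a b : ℝ) :
    IntervalIntegrable (fun θ => F (Pp t θ)) volume a b := (comp_cont hF t).intervalIntegrable _ _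

lemma cI_add {F G : Pl → ℝ} (hF : Continuous F) (hG : Continuous G) (t : ℝ) :
    cI (fun x => F x + G x) t = cI F t + cI G t :=
  intervalIntegral.integral_add (cI_ii hF t _ _) (cI_ii hG t _ _)

lemma cI_sub {F G : Pl → ℝ} (hF : Continuous F) (hG : Continuous G) (t : ℝ) :
    cI (fun x => F x - G x) t = cI F t - cI G t :=
  intervalIntegral.integral_sub (cI_ii hF t _ _) (cI_ii hG t _ _)

lemma cI_smul (c : ℝ) (F : Pl → ℝ) (t : ℝ) :
    cI (fun x => c * F x) t = c * cI F t := intervalIntegral.integral_const_mul _ _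

lemma cI_nsq (F : Pl → ℝ) (t : ℝ) :
    cI (fun x => nsq x * F x) t = Real.exp (2 * t) * cI F t := by
  simp only [cI, Pp_nsq]; exact intervalIntegral.integral_const_mul _ _

lemma cI_mono {F G : Pl → ℝ} (hF : Continuous F) (hG : Continuous G) (h : ∀ x, F x ≤ G x) (t : ℝ) :
    cI F t ≤ cI G t :=
  intervalIntegral.integral_mono_on (by positivity) (cI_ii hF t _ _) (cI_ii hG t _ _)
    (fun θ _ => h _)

lemma cI_nonneg {F : Pl → ℝ} (h : ∀ x, 0 ≤ F x) (t : ℝ) : 0 ≤ cI F t :=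
  intervalIntegral.integral_nonneg (by positivity) (fun θ _ => h _)

lemma cI_pos {F : Pl → ℝ} (hF : Continuous F) (h : ∀ x, 0 < F x) (t : ℝ) : 0 < cI F t :=
  intervalIntegral.intervalIntegral_pos_of_pos (cI_ii hF t _ _) (fun θ => h _) (by positivity)

lemma cI_Td {X : Pl → ℝ} (hX : ContDiff ℝ 1 X) (t : ℝ) : cI (Td X) t = 0 := by
  unfold cI
  rw [intervalIntegral.integral_eq_sub_of_hasDerivAt (fun θ _ => comp_dθ hX t θ)
    (cI_ii (Td_C0 hX) t _ _)]
  simp [Pp]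

lemma cI_deriv {F : Pl → ℝ} (hF : ContDiff ℝ 1 F) (t : ℝ) :
    HasDerivAt (cI F) (cI (Rd F) t) t := by
  have hR := Rd_C0 hF
  obtain ⟨B, hB⟩ := ((isCompact_Icc (a := t - 1) (b := t + 1)).prod
    (isCompact_Icc (a := (0:ℝ)) (b := 2 * Real.pi))).exists_bound_of_continuousOn
    (comp_cont2 hR).continuousOn
  refine (intervalIntegral.hasDerivAt_integral_of_dominated_loc_of_deriv_le
    (F := fun t θ => F (Pp t θ)) (F' := fun t θ => Rd F (Pp t θ)) (bound := fun _ => B)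
    (Metric.ball_mem_nhds t one_pos) ?_ (cI_ii hF.continuous t _ _)
    (comp_cont hR t).aestronglyMeasurable ?_ intervalIntegrable_const ?_).2
  · exact Filter.Eventually.of_forall fun s => (comp_cont hF.continuous s).aestronglyMeasurable
  · refine Filter.Eventually.of_forall fun θ hθ s hs => ?_
    rw [Set.uIoc_of_le (by positivity)] at hθ
    rw [Metric.mem_ball, Real.dist_eq, abs_lt] at hs
    exact hB (s, θ) ⟨⟨by linarith [hs.1], by linarith [hs.2]⟩, hθ.1.le, hθ.2⟩
  · exact Filter.Eventually.of_forall fun θ _ s _ => comp_dt hF s θ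

lemma cI_deriv' {F X G : Pl → ℝ} (hF : ContDiff ℝ 1 F) (hX : ContDiff ℝ 1 X)
    (h : ∀ x, Rd F x + Td X x = G x) (t : ℝ) : HasDerivAt (cI F) (cI G t) t := by
  have e : G = fun x => Rd F x + Td X x := funext fun x => (h x).symm
  rw [e, cI_add (Rd_C0 hF) (Td_C0 hX), cI_Td hX, add_zero]
  exact cI_deriv hF t

/-- A circle integral of a continuous function vanishing at the origin tends to zero. -/
lemma cI_tendsto {F : Pl → ℝ} (hF : Continuous F) (h0 : F 0 = 0) :
    Filter.Tendsto (cI F) Filter.atBot (nhds 0) := by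
  let g : ℝ → ℝ := fun r => ∫ θ in (0:ℝ)..(2 * Real.pi), F (!₂[r * Real.cos θ, r * Real.sin θ])
  have hg : Continuous g :=
    intervalIntegral.continuous_parametric_intervalIntegral_of_continuous'
      (f := fun r θ => F (!₂[r * Real.cos θ, r * Real.sin θ])) (hF.comp (by fun_prop)) _ _
  have hg0 : g 0 = 0 := by
    have : (!₂[(0:ℝ), 0] : Pl) = 0 := by ext i; fin_cases i <;> simp
    simp [g, this, h0]
  have := (hg.tendsto 0).comp Real.tendsto_exp_atBot
  rw [hg0] at this
  exact this

lemma nonneg_of_deriv {F : Pl → ℝ} (hF : Continuous F) (h0 : F 0 = 0) {G : ℝ → ℝ}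
    (hd : ∀ t, HasDerivAt (cI F) (G t) t) (hG : ∀ t, 0 ≤ G t) (t : ℝ) : 0 ≤ cI F t := by
  have hm : Monotone (cI F) := monotone_of_hasDerivAt_nonneg hd hG
  exact le_of_tendsto (cI_tendsto hF h0)
    ((Filter.eventually_le_atBot t).mono fun s hs => hm hs)

lemma limit_deriv (A D : ℝ → ℝ → ℝ) (hA : Continuous (fun p : ℝ × ℝ => A p.1 p.2))
    (hD : Continuous (fun p : ℝ × ℝ => D p.1 p.2))
    (h : ∀ k, k ≠ 0 → ∀ t, HasDerivAt (A k) (D k t) t) (t : ℝ) : HasDerivAt (A 0) (D 0 t) t := by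
  have hDk : ∀ k, Continuous (D k) := fun k => hD.comp (Continuous.prodMk_right k)
  have key : ∀ t, A 0 t = A 0 0 + ∫ s in (0:ℝ)..t, D 0 s := by
    intro t
    have c1 : Continuous (fun k => A k t) := hA.comp (Continuous.prodMk_left t)
    have c2 : Continuous (fun k => A k 0 + ∫ s in (0:ℝ)..t, D k s) :=
      (hA.comp (Continuous.prodMk_left 0)).add
        (intervalIntegral.continuous_parametric_intervalIntegral_of_continuous' hD _ _)
    have hdense : Dense ({0}ᶜ : Set ℝ) := dense_compl_singleton 0
    have := Continuous.ext_on hdense c1 c2 (fun k hk => by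
      have := intervalIntegral.integral_eq_sub_of_hasDerivAt (f := A k) (f' := D k)
        (a := 0) (b := t) (fun s _ => h k hk s) ((hDk k).intervalIntegrable _ _)
      rw [this]; ring)
    exact congrFun this 0
  have e : A 0 = fun t => A 0 0 + ∫ s in (0:ℝ)..t, D 0 s := funext key
  rw [e]
  exact (intervalIntegral.integral_hasDerivAt_right ((hDk 0).intervalIntegrable _ _)
    ((hDk 0).stronglyMeasurableAtFilter _ _) (hDk 0).continuousAt).const_add _

lemma weak0 {g s : Pl → ℝ} (hg : ContDiff ℝ 2 g) (hs : ContDiff ℝ 1 s) (t : ℝ) :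
    HasDerivAt (cI (fun x => s x * Rd g x))
      (cI (fun x => Rd s x * Rd g x + Td s x * Td g x + s x * (nsq x * lapl g x)) t) t := by
  have hR := Rd_C1 hg
  have hT := Td_C1 hg
  refine cI_deriv' (X := fun x => s x * Td g x) (hs.mul hR) (hs.mul hT) (fun x => ?_) t
  rw [dv_mul (C1_diff hs x) (C1_diff hR x), dv_mul (C1_diff hs x) (C1_diff hT x),
    ← (second_order hg x).2]
  ring

/-- Averages along segments in a coordinate direction. -/
noncomputable def Qh (j : Fin 2) (h : ℝ) (F : Pl → ℝ) (x : Pl) : ℝ :=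
  ∫ τ in (0:ℝ)..1, F (x + (τ * h) • (EuclideanSpace.single j 1 : Pl))

lemma Qh_cont {j : Fin 2} {F : Pl → ℝ} (hF : Continuous F) :
    Continuous (fun p : ℝ × Pl => Qh j p.1 F p.2) :=
  intervalIntegral.continuous_parametric_intervalIntegral_of_continuous'
    (f := fun (p : ℝ × Pl) τ => F (p.2 + (τ * p.1) • (EuclideanSpace.single j 1 : Pl)))
    (hF.comp (by fun_prop)) _ _

lemma Qh_zero (j : Fin 2) (F : Pl → ℝ) (x : Pl) : Qh j 0 F x = F x := by simp [Qh]

lemma Qh_slope {j : Fin 2} {F : Pl → ℝ} (hF : ContDiff ℝ 1 F) {h : ℝ} (h0 : h ≠ 0) (x : Pl) :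
    h⁻¹ * (F (x + h • (EuclideanSpace.single j 1 : Pl)) - F x) = Qh j h (pd j F) x := by
  set e : Pl := EuclideanSpace.single j 1
  have hd : ∀ τ : ℝ, HasDerivAt (fun τ : ℝ => F (x + (τ * h) • e)) (h * pd j F (x + (τ * h) • e)) τ := by
    intro τ
    have h1 : HasDerivAt (fun τ : ℝ => x + (τ * h) • e) (h • e) τ := by
      have := ((hasDerivAt_id τ).mul_const h).smul_const e
      simpa using this.const_add x
    have h2 := (C1_diff hF (x + (τ * h) • e)).hasFDerivAt.comp_hasDerivAt τ h1
    rw [map_smul] at h2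
    exact h2
  have hc : Continuous (fun τ : ℝ => pd j F (x + (τ * h) • e)) :=
    (pd_C0 hF j).comp (by fun_prop)
  have := intervalIntegral.integral_eq_sub_of_hasDerivAt (a := 0) (b := 1) (fun τ _ => hd τ)
    ((hc.const_mul h).intervalIntegrable _ _)
  rw [intervalIntegral.integral_const_mul] at this
  simp only [one_mul, zero_mul, zero_smul, add_zero] at this
  rw [← this]
  unfold Qh
  field_simp
  rfl

lemma pd_quot {j i : Fin 2} {F : Pl → ℝ} (hF : ContDiff ℝ 1 F) (h : ℝ) (x : Pl) :
    pd i (fun x => h⁻¹ * (F (x + h • (EuclideanSpace.single j 1 : Pl)) - F x)) x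
      = h⁻¹ * (pd i F (x + h • (EuclideanSpace.single j 1 : Pl)) - pd i F x) := by
  set e : Pl := EuclideanSpace.single j 1
  have hd : DifferentiableAt ℝ (fun x => F (x + h • e)) x :=
    C1_diff (hF.comp (contDiff_id.add contDiff_const)) x
  rw [dv_mul (differentiableAt_const _) (hd.fun_sub (C1_diff hF x)), dv_const, mul_zero, add_zero,
    dv_sub hd (C1_diff hF x)]
  congr 2
  simp only [dv, fderiv_comp_add_right]
  rfl

lemma weak1 {u f s : Pl → ℝ} (j : Fin 2) (hu : ContDiff ℝ 2 u) (hf : ContDiff ℝ 1 f)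
    (hl : ∀ x, lapl u x = f x) (hs : ContDiff ℝ 1 s) (t : ℝ) :
    HasDerivAt (cI (fun x => s x * Rd (pd j u) x))
      (cI (fun x => Rd s x * Rd (pd j u) x + Td s x * Td (pd j u) x
        + s x * (nsq x * pd j f x)) t) t := by
  set q : ℝ → Fin 2 → Pl → ℝ := fun h i x => Qh j h (pd j (pd i u)) x with hq
  set r : ℝ → Pl → ℝ := fun h x => x 0 * q h 0 x + x 1 * q h 1 x with hr
  set w : ℝ → Pl → ℝ := fun h x => -x 1 * q h 0 x + x 0 * q h 1 x with hw
  set l : ℝ → Pl → ℝ := fun h x => Qh j h (pd j f) x with hldef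
  have qc : ∀ i, Continuous (fun p : ℝ × Pl => q p.1 i p.2) := fun i =>
    Qh_cont (pd_C0 (pd_C1 hu i) j)
  have lc : Continuous (fun p : ℝ × Pl => l p.1 p.2) := Qh_cont (pd_C0 hf j)
  have q0 := qc 0
  have q1 := qc 1
  have rc : Continuous (fun p : ℝ × Pl => r p.1 p.2) := by
    simp only [hr]; fun_prop
  have wc : Continuous (fun p : ℝ × Pl => w p.1 p.2) := by
    simp only [hw]; fun_prop
  have sc := hs.continuous
  have Rc := Rd_C0 hs
  have Tc := Td_C0 hs
  have nc : Continuous nsq := (nsq_contDiff (n := 0)).continuous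
  -- joint continuity of circle integrals
  have joint : ∀ G : ℝ → Pl → ℝ, Continuous (fun p : ℝ × Pl => G p.1 p.2) →
      Continuous (fun p : ℝ × ℝ => cI (G p.1) p.2) := by
    intro G hG
    refine intervalIntegral.continuous_parametric_intervalIntegral_of_continuous'
      (f := fun (p : ℝ × ℝ) θ => G p.1 (Pp p.2 θ)) ?_ _ _
    have : Continuous (fun z : (ℝ × ℝ) × ℝ => (z.1.1, Pp z.1.2 z.2)) :=
      (continuous_fst.comp continuous_fst).prodMk
        (Pp_cont.comp ((continuous_snd.comp continuous_fst).prodMk continuous_snd))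
    exact hG.comp this
  have main := limit_deriv (fun h t => cI (fun x => s x * r h x) t)
    (fun h t => cI (fun x => Rd s x * r h x + Td s x * w h x + s x * (nsq x * l h x)) t)
    (joint (fun h x => s x * r h x) (by fun_prop))
    (joint (fun h x => Rd s x * r h x + Td s x * w h x + s x * (nsq x * l h x)) (by fun_prop))
    (by
      intro h h0 t
      set gh : Pl → ℝ := fun x => h⁻¹ * (u (x + h • (EuclideanSpace.single j 1 : Pl)) - u x) with hgh
      have hgC : ContDiff ℝ 2 gh := by
        have : ContDiff ℝ 2 (fun x => u (x + h • (EuclideanSpace.single j 1 : Pl))) :=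
          hu.comp (contDiff_id.add contDiff_const)
        exact contDiff_const.mul (this.sub hu)
      have hu1 : ContDiff ℝ 1 u := hu.of_le (by norm_num)
      have p1 : ∀ i, pd i gh = fun x => h⁻¹ * (pd i u (x + h • (EuclideanSpace.single j 1 : Pl))
        - pd i u x) := fun i => funext fun x => pd_quot hu1 h x
      have p2 : ∀ i, pd i gh = q h i := fun i => by
        rw [p1]; funext x; exact Qh_slope (pd_C1 hu i) h0 x
      have p3 : ∀ x, lapl gh x = l h x := by
        intro x
        rw [lapl_eq, p1, p1, pd_quot (pd_C1 hu 0), pd_quot (pd_C1 hu 1)]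
        have := Qh_slope (j := j) hf h0 x
        simp only [hldef]
        rw [← this, ← hl, ← hl, lapl_eq, lapl_eq]
        ring
      have eR : Rd gh = r h := by
        funext x; rw [Rd_eq, p2, p2]
      have eT : Td gh = w h := by
        funext x; rw [Td_eq, p2, p2]
      have := weak0 hgC hs t
      simp only [eR, eT, p3] at this
      exact this) t
  have z : ∀ i, q 0 i = pd i (pd j u) := fun i => by
    funext x; simp only [hq, Qh_zero]; exact pd_comm hu x j i
  have zr : r 0 = Rd (pd j u) := by funext x; rw [Rd_eq, ← z, ← z]
  have zw : w 0 = Td (pd j u) := by funext x; rw [Td_eq, ← z, ← z]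
  have zl : l 0 = pd j f := by funext x; simp only [hldef, Qh_zero]
  simp only [zr, zw, zl] at main
  exact main

/-- Slope of level lines. -/
noncomputable def sg (u : Pl → ℝ) (x : Pl) : ℝ := pd 0 u x / pd 1 u x

/-- The field `V` applied to the gradient ratio, rescaled. -/
noncomputable def Gv (V : Pl → Pl) (u : Pl → ℝ) (x : Pl) : ℝ :=
  dv V (pd 0 u) x - sg u x * dv V (pd 1 u) x

/-- Boundary density. -/
noncomputable def Iu (u : Pl → ℝ) (x : Pl) : ℝ := pd 0 u x * Gv Ef u x

lemma sg_C1 {u : Pl → ℝ} (hu : ContDiff ℝ 2 u) (hq : ∀ x, pd 1 u x ≠ 0) : ContDiff ℝ 1 (sg u) := (pd_C1 hu 0).div (pd_C1 hu 1) hq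

lemma Gv_cont {u : Pl → ℝ} (hu : ContDiff ℝ 2 u) (hq : ∀ x, pd 1 u x ≠ 0)
    {V : Pl → Pl} (hV : Continuous V) : Continuous (Gv V u) := by
  have h : ∀ i, Continuous (dv V (pd i u)) := fun i =>
    (dv_contDiff (n := 0) (contDiff_zero.2 hV) (pd_C1 hu i) (by norm_num)).continuous
  exact (h 0).sub ((sg_C1 hu hq).continuous.mul (h 1))

lemma Iu_cont {u : Pl → ℝ} (hu : ContDiff ℝ 2 u) (hq : ∀ x, pd 1 u x ≠ 0) : Continuous (Iu u) :=
  (pd_C1 hu 0).continuous.mul (Gv_cont hu hq continuous_id)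

lemma Iu_deriv {u f : Pl → ℝ} (hu : ContDiff ℝ 2 u) (hq : ∀ x, pd 1 u x ≠ 0)
    (hf : ContDiff ℝ 1 f) (hl : ∀ x, lapl u x = f x) (t : ℝ) :
    HasDerivAt (cI (Iu u)) (cI (fun x => Gv Ef u x ^ 2 + Gv Jf u x ^ 2
      + nsq x * (pd 0 u x * (pd 0 f x - sg u x * pd 1 f x))) t) t := by
  have hp := pd_C1 hu 0
  have hqq := pd_C1 hu 1
  have hs : ContDiff ℝ 1 (sg u) := sg_C1 hu hq
  have hs2 : ContDiff ℝ 1 (fun x => -(sg u x * pd 0 u x)) := (hs.mul hp).neg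
  have w1 := weak1 0 hu hf hl hp t
  have w2 := weak1 1 hu hf hl hs2 t
  have nc : Continuous nsq := (nsq_contDiff (n := 0)).continuous
  have a1 := hp.continuous
  have a2 := hqq.continuous
  have a3 := hs.continuous
  have a4 := Rd_C0 hp
  have a5 := Rd_C0 hqq
  have a6 := Td_C0 hp
  have a7 := Td_C0 hqq
  have a8 := Rd_C0 hs2
  have a9 := Td_C0 hs2
  have b1 := pd_C0 hf 0
  have b2 := pd_C0 hf 1
  have w := w1.fun_add w2
  rw [← cI_add (by fun_prop) (by fun_prop)] at w
  have e1 : (cI (Iu u)) = fun t => cI (fun x => pd 0 u x * Rd (pd 0 u) x) t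
      + cI (fun x => -(sg u x * pd 0 u x) * Rd (pd 1 u) x) t := by
    funext t
    rw [← cI_add (by fun_prop) (by fun_prop)]
    congr 1
    funext x
    simp only [Iu, Gv]; ring
  rw [e1]
  refine w.congr_deriv ?_
  congr 1
  funext x
  have dvs : ∀ V, dv V (fun x => -(sg u x * pd 0 u x)) x
      = -(2 * sg u x * dv V (pd 0 u) x - sg u x ^ 2 * dv V (pd 1 u) x) := by
    intro V
    rw [dv_neg, dv_mul (C1_diff hs x) (C1_diff hp x)]
    have : dv V (sg u) x = (dv V (pd 0 u) x - pd 0 u x / pd 1 u x * dv V (pd 1 u) x) / pd 1 u x :=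
      dv_div (C1_diff hp x) (C1_diff hqq x) (hq x)
    rw [this, sg]
    have := hq x
    field_simp; ring
  rw [dvs, dvs]
  simp only [Gv]; ring

lemma dv_sg {u : Pl → ℝ} (hu : ContDiff ℝ 2 u) (hq : ∀ x, pd 1 u x ≠ 0)
    (V : Pl → Pl) (x : Pl) : dv V (sg u) x = Gv V u x / pd 1 u x :=
  dv_div (C1_diff (pd_C1 hu 0) x) (C1_diff (pd_C1 hu 1) x) (hq x)

/-- Vanishing of a nonnegative function with zero circle integrals. -/
lemma cI_zero {F : Pl → ℝ} (hF : Continuous F) (h0 : ∀ x, 0 ≤ F x) (h : ∀ t, cI F t = 0)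
    (x : Pl) (hx : x ≠ 0) : F x = 0 := by
  have key : ∀ t, ∀ θ ∈ Set.Icc (0:ℝ) (2 * Real.pi), F (Pp t θ) = 0 := by
    intro t θ hθ
    by_contra hne
    have hp : 0 < F (Pp t θ) := lt_of_le_of_ne (h0 _) (Ne.symm hne)
    have := intervalIntegral.integral_pos (a := 0) (b := 2 * Real.pi) (f := fun θ => F (Pp t θ))
      (by positivity) (comp_cont hF t).continuousOn (fun _ _ => h0 _) ⟨θ, hθ, hp⟩
    have h2 := h t
    unfold cI at h2
    linarith
  set z : ℂ := ⟨x 0, x 1⟩ with hz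
  have hz0 : z ≠ 0 := by
    intro h
    apply hx
    have h1 : x 0 = 0 := congrArg Complex.re h
    have h2 : x 1 = 0 := congrArg Complex.im h
    ext i; fin_cases i <;> simp [h1, h2]
  have hn : 0 < ‖z‖ := norm_pos_iff.2 hz0
  have c1 : ‖z‖ * Real.cos z.arg = x 0 := Complex.norm_mul_cos_arg z
  have c2 : ‖z‖ * Real.sin z.arg = x 1 := Complex.norm_mul_sin_arg z
  obtain ⟨θ, hθ, e1, e2⟩ : ∃ θ ∈ Set.Icc (0:ℝ) (2 * Real.pi), Real.cos θ = Real.cos z.arg ∧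
      Real.sin θ = Real.sin z.arg := by
    rcases le_total 0 z.arg with ha | ha
    · exact ⟨z.arg, ⟨ha, by linarith [Complex.arg_le_pi z, Real.pi_pos]⟩, rfl, rfl⟩
    · exact ⟨z.arg + 2 * Real.pi, ⟨by linarith [Complex.neg_pi_lt_arg z, Real.pi_pos], by linarith⟩,
        Real.cos_add_two_pi _, Real.sin_add_two_pi _⟩
  have : x = Pp (Real.log ‖z‖) θ := by
    ext i
    fin_cases i <;> simp [Pp, Real.exp_log hn, e1, e2, c1, c2]
  rw [this]
  exact key _ _ hθ

lemma eq_of_ne_zero {F G : Pl → ℝ} (hF : Continuous F) (hG : Continuous G)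
    (h : ∀ x, x ≠ 0 → F x = G x) (x : Pl) : F x = G x := by
  have hdense : Dense ({0}ᶜ : Set Pl) := dense_compl_singleton 0
  exact congrFun (Continuous.ext_on hdense hF hG (fun x hx => h x hx)) x

/-- Functions with constant slope are functions of one variable. -/
lemma one_dim {u : Pl → ℝ} (hu : ContDiff ℝ 1 u) (c : ℝ) (h : ∀ x, pd 0 u x = c * pd 1 u x)
    (x : Pl) (s : ℝ) : u (x + s • (!₂[1, -c] : Pl)) = u x := by
  have hd : ∀ s : ℝ, HasDerivAt (fun s : ℝ => u (x + s • (!₂[1, -c] : Pl))) 0 s := by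
    intro s
    have h1 : HasDerivAt (fun s : ℝ => x + s • (!₂[1, -c] : Pl)) (!₂[1, -c] : Pl) s := by
      simpa using ((hasDerivAt_id s).smul_const (!₂[1, -c] : Pl)).const_add x
    have h2 := (C1_diff hu (x + s • (!₂[1, -c] : Pl))).hasFDerivAt.comp_hasDerivAt s h1
    have e : dv (fun _ => !₂[1, -c]) u (x + s • (!₂[1, -c] : Pl)) = 0 := by
      rw [dv_eq, h]; simp
    exact h2.congr_deriv e
  have := is_const_of_deriv_eq_zero (fun s => (hd s).differentiableAt) (fun s => (hd s).deriv) s 0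
  simpa using this

/-- Riccati step on a unit interval. -/
lemma ode_step (Y D M a I I' : ℝ → ℝ) (t m L B : ℝ)
    (hY : ∀ t, HasDerivAt Y (D t) t) (hI : ∀ t, HasDerivAt I (I' t) t)
    (hMa : ∀ t, M t * a t ≤ (D t + Y t ^ 2) / 2) (hD : ∀ t, 0 ≤ D t) (ha : ∀ t, 0 ≤ a t)
    (h2 : ∀ t l, 2 * l * I t - l ^ 2 * a t ≤ I' t)
    (hIt : 0 < I t) (hm : 0 < m) (hmM : ∀ s ∈ Set.Icc t (t + 1), m ≤ M s)
    (hL : ∀ s ∈ Set.Icc t (t + 1), Y s ^ 2 ≤ L) (hB : 0 < B)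
    (hBB : (Y (t + 1) - Y t + L) / (2 * m) ≤ B) :
    1 / B ≤ 1 / I t - 1 / I (t + 1) := by
  have hmono : Monotone I := monotone_of_hasDerivAt_nonneg hI (fun s => by
    have := h2 s 0; simpa using this)
  have hpos : ∀ s ∈ Set.Icc t (t + 1), 0 < I s := fun s hs => lt_of_lt_of_le hIt (hmono hs.1)
  set n : ℝ := 1 / B with hn
  let f : ℝ → ℝ := fun s => - (I s)⁻¹ - 2 * n * s + n ^ 2 * (Y s + L * s) / (2 * m)
  have hf : ∀ s ∈ Set.Icc t (t + 1), HasDerivAt f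
      (-(- I' s / I s ^ 2) - 2 * n + n ^ 2 * (D s + L) / (2 * m)) s := by
    intro s hs
    have e1 := ((hI s).fun_inv (hpos s hs).ne').fun_neg
    have e2 := (hasDerivAt_id s).const_mul (2 * n)
    have e3 := (((hY s).fun_add ((hasDerivAt_id s).const_mul L)).const_mul (n ^ 2)).div_const (2 * m)
    simpa [f] using (e1.fun_sub e2).fun_add e3
  have hfm : MonotoneOn f (Set.Icc t (t + 1)) := by
    apply monotoneOn_of_deriv_nonneg (convex_Icc _ _)
      (fun s hs => (hf s hs).continuousAt.continuousWithinAt)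
      (fun s hs => (hf s (interior_subset hs)).differentiableAt.differentiableWithinAt)
    intro s hs
    have hs := interior_subset hs
    rw [(hf s hs).deriv]
    have hp := hpos s hs
    have q1 := h2 s (n * I s)
    have q2 : 2 * n - n ^ 2 * a s ≤ I' s / I s ^ 2 := by
      rw [le_div_iff₀ (by positivity)]; nlinarith
    have q3 : a s ≤ (D s + L) / (2 * m) := by
      rw [le_div_iff₀ (by positivity)]
      have := hMa s
      have := hL s hs
      have := mul_le_mul_of_nonneg_right (hmM s hs) (ha s)
      nlinarith
    have q4 := mul_le_mul_of_nonneg_left q3 (sq_nonneg n)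
    have : n ^ 2 * (D s + L) / (2 * m) = n ^ 2 * ((D s + L) / (2 * m)) := by ring
    rw [this, neg_div, neg_neg]; linarith
  have hle := hfm (Set.left_mem_Icc.2 (by linarith)) (Set.right_mem_Icc.2 (by linarith)) (by linarith : t ≤ t + 1)
  simp only [f] at hle
  have q5 : n ^ 2 * ((Y (t + 1) - Y t + L) / (2 * m)) ≤ n ^ 2 * B :=
    mul_le_mul_of_nonneg_left hBB (sq_nonneg n)
  have q6 : n ^ 2 * B = n := by rw [hn]; field_simp
  have q7 : n ^ 2 * (Y (t + 1) + L * (t + 1)) / (2 * m) - n ^ 2 * (Y t + L * t) / (2 * m)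
    = n ^ 2 * ((Y (t + 1) - Y t + L) / (2 * m)) := by ring
  rw [one_div, one_div]
  linarith

/-- The ODE part of the argument. -/
lemma ode_main (H H1 H2 a w I I' k' : ℝ → ℝ)
    (hH : ∀ t, HasDerivAt H (H1 t) t) (hH1 : ∀ t, HasDerivAt H1 (H2 t) t)
    (hpos : ∀ t, 0 < H t) (hH2 : ∀ t, H2 t = 2 * Real.exp (2 * t) * (a t + 2 * w t))
    (hcs : ∀ t, H1 t ^ 2 ≤ H t * (H2 t - 2 * Real.exp (2 * t) * w t))
    (ha : ∀ t, 0 ≤ a t) (hw : ∀ t, 0 ≤ w t)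
    (hI : ∀ t, HasDerivAt I (I' t) t)
    (hk : ∀ t, HasDerivAt (fun t => a t - w t) (k' t) t)
    (h1 : ∀ t l, 2 * l * I t + l * k' t - l ^ 2 * a t ≤ I' t)
    (h2 : ∀ t l, 2 * l * I t - l ^ 2 * a t ≤ I' t)
    (hI0 : ∀ t, 0 ≤ I t) (c b : ℝ) (hgr : ∀ t, 0 ≤ t → H t ≤ Real.exp (c + b * t)) :
    ∀ t, I t = 0 := by
  have hmono : Monotone I := monotone_of_hasDerivAt_nonneg hI (fun s => by
    have := h2 s 0; simpa using this)
  set Y : ℝ → ℝ := fun t => H1 t / H t with hYdef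
  set D : ℝ → ℝ := fun t => H2 t / H t - Y t ^ 2 with hDdef
  set M : ℝ → ℝ := fun t => Real.exp (2 * t) / H t with hMdef
  have hMpos : ∀ t, 0 < M t := fun t => div_pos (Real.exp_pos _) (hpos t)
  have hY : ∀ t, HasDerivAt Y (D t) t := by
    intro t
    have := (hH1 t).fun_div (hH t) (hpos t).ne'
    refine this.congr_deriv ?_
    have := (hpos t).ne'
    change _ = H2 t / H t - (H1 t / H t) ^ 2
    field_simp
  have hMw : ∀ t, M t * w t ≤ D t / 2 := by
    intro t
    have h := hcs t
    have hp := hpos t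
    have e : D t / 2 - M t * w t
        = (H t * (H2 t - 2 * Real.exp (2 * t) * w t) - H1 t ^ 2) / (2 * H t ^ 2) := by
      simp only [hDdef, hYdef, hMdef]; field_simp; ring
    have : 0 ≤ D t / 2 - M t * w t := by
      rw [e]; apply div_nonneg <;> [linarith; positivity]
    linarith
  have hMw0 : ∀ t, 0 ≤ M t * w t := fun t => mul_nonneg (hMpos t).le (hw t)
  have hD : ∀ t, 0 ≤ D t := fun t => by linarith [hMw t, hMw0 t]
  have hMae : ∀ t, M t * a t = (D t + Y t ^ 2) / 2 - 2 * (M t * w t) := by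
    intro t
    have := (hpos t).ne'
    simp only [hDdef, hMdef]; rw [hH2]; field_simp; ring
  have hMa : ∀ t, M t * a t ≤ (D t + Y t ^ 2) / 2 := fun t => by linarith [hMae t, hMw0 t]
  have hYm : Monotone Y := monotone_of_hasDerivAt_nonneg hY hD
  have hM' : ∀ t, HasDerivAt M ((2 - Y t) * M t) t := by
    intro t
    have e1 : HasDerivAt (fun t => Real.exp (2 * t)) (Real.exp (2 * t) * 2) t := by
      simpa using ((hasDerivAt_id t).const_mul 2).exp
    have := e1.fun_div (hH t) (hpos t).ne'
    refine this.congr_deriv ?_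
    have := (hpos t).ne'
    change _ = (2 - H1 t / H t) * (Real.exp (2 * t) / H t)
    field_simp
  have hlogH : ∀ t, HasDerivAt (fun t => Real.log (H t)) (Y t) t := fun t =>
    (hH t).log (hpos t).ne'
  have hlogM : ∀ t, HasDerivAt (fun t => Real.log (M t)) (2 - Y t) t := fun t => by
    have := (hM' t).log (hMpos t).ne'
    convert this using 1
    have := (hMpos t).ne'
    field_simp
  -- boundedness of Y
  have hYb : ∀ t, Y t ≤ b := by
    intro t0
    set t1 := max t0 0
    refine (hYm (le_max_left t0 0)).trans ?_
    by_contra! hcon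
    have hm : MonotoneOn (fun t => Real.log (H t) - Y t1 * t) (Set.Ici t1) := by
      have hd : ∀ s, HasDerivAt (fun t => Real.log (H t) - Y t1 * t) (Y s - Y t1) s := fun s => by
        simpa using (hlogH s).fun_sub ((hasDerivAt_id s).const_mul (Y t1))
      apply monotoneOn_of_deriv_nonneg (convex_Ici _)
        (fun s hs => (hd s).continuousAt.continuousWithinAt)
        (fun s hs => (hd s).differentiableAt.differentiableWithinAt)
      intro s hs
      rw [(hd s).deriv]
      linarith [hYm (interior_subset hs : t1 ≤ s)]
    obtain ⟨T, hT⟩ : ∃ T : ℝ, T * (Y t1 - b) > c - (Real.log (H t1) - Y t1 * t1) := by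
      refine ⟨(c - (Real.log (H t1) - Y t1 * t1) + 1) / (Y t1 - b), ?_⟩
      rw [div_mul_cancel₀ _ (sub_pos.2 hcon).ne']
      linarith
    set s := max T t1
    have hs0 : 0 ≤ s := (le_max_right t0 0).trans (le_max_right T t1)
    have e1 := hm (Set.mem_Ici.2 le_rfl) (Set.mem_Ici.2 (le_max_right T t1)) (le_max_right T t1)
    have e2 : Real.log (H s) ≤ c + b * s := by
      rw [Real.log_le_iff_le_exp (hpos s)]; exact hgr s hs0
    have e3 : T * (Y t1 - b) ≤ s * (Y t1 - b) :=
      mul_le_mul_of_nonneg_right (le_max_left T t1) (by linarith)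
    simp only at e1
    change Real.log (H t1) - Y t1 * t1 ≤ Real.log (H s) - Y t1 * s at e1
    nlinarith
  have hbdd : BddAbove (Set.range Y) := ⟨b, by rintro _ ⟨t, rfl⟩; exact hYb t⟩
  set L := ⨆ t, Y t with hL
  have hYL : ∀ t, Y t ≤ L := fun t => le_ciSup hbdd t
  by_contra! hne
  obtain ⟨t0', ht0'⟩ := hne
  have hpos0' : 0 < I t0' := lt_of_le_of_ne (hI0 _) (Ne.symm ht0')
  rcases le_or_gt L 2 with hL2 | hL2
  · -- linear growth
    set t0 := max t0' 0
    have ht0 : 0 ≤ t0 := le_max_right _ _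
    have hp0 : 0 < I t0 := lt_of_lt_of_le hpos0' (hmono (le_max_left _ _))
    have hlm : Monotone (fun t => Real.log (M t)) :=
      monotone_of_hasDerivAt_nonneg hlogM (fun s => by linarith [hYL s] : ∀ s, 0 ≤ 2 - Y s)
    have hMm : ∀ s, 0 ≤ s → M 0 ≤ M s := fun s hs =>
      (Real.log_le_log_iff (hMpos 0) (hMpos s)).1 (hlm hs)
    set B : ℝ := (2 - Y 0 + (Y 0 ^ 2 + 4)) / (2 * M 0) with hB
    have hBp : 0 < B := div_pos (by nlinarith [sq_nonneg (Y 0 - 1), sq_nonneg (Y 0)]) (by linarith [hMpos 0])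
    have step : ∀ t, t0 ≤ t → 1 / B ≤ 1 / I t - 1 / I (t + 1) := by
      intro t ht
      apply ode_step Y D M a I I' t (M 0) (Y 0 ^ 2 + 4) B hY hI hMa hD ha h2
        (lt_of_lt_of_le hp0 (hmono ht)) (hMpos 0) (fun s hs => hMm s (by linarith [hs.1]))
      · intro s hs
        have q1 : Y 0 ≤ Y s := hYm (by linarith [hs.1])
        have q2 := hYL s
        rcases le_total 0 (Y s) with h | h <;> nlinarith
      · exact hBp
      · apply div_le_div_of_nonneg_right _ (by linarith [hMpos 0])
        have := hYL (t + 1)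
        have : Y 0 ≤ Y t := hYm (by linarith)
        linarith
    have key : ∀ n : ℕ, n / B ≤ 1 / I t0 - 1 / I (t0 + n) := by
      intro n
      induction n with
      | zero => simp
      | succ n ih =>
        have := step (t0 + n) (by simp)
        push_cast
        rw [← add_assoc, add_div]
        linarith
    obtain ⟨n, hn⟩ := exists_nat_gt (B * (1 / I t0))
    have h3 := key n
    have h4 : 0 < 1 / I (t0 + n) := by
      have : 0 < I (t0 + n) := lt_of_lt_of_le hp0 (hmono (by simp))
      positivity
    have h5 : n / B ≤ 1 / I t0 := by linarith
    rw [div_le_iff₀ hBp] at h5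
    linarith
  · -- superlinear growth is impossible
    set μ := (L - 2) / 2 with hμ
    have hμp : 0 < μ := by rw [hμ]; linarith
    obtain ⟨t1, ht1⟩ : ∃ t1, 2 + 3 * μ / 2 < Y t1 := exists_lt_of_lt_ciSup (by rw [← hL]; rw [hμ] ; linarith)
    have hYt : ∀ t, t1 ≤ t → 2 + 3 * μ / 2 ≤ Y t := fun t ht => ht1.le.trans (hYm ht)
    have hLm : Monotone (fun t => Real.log (M t) + L * t) := by
      have hd : ∀ s, HasDerivAt (fun t => Real.log (M t) + L * t) (2 - Y s + L) s := fun s => by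
        simpa using (hlogM s).fun_add ((hasDerivAt_id s).const_mul L)
      exact monotone_of_hasDerivAt_nonneg hd (fun s => by linarith [hYL s] : ∀ s, 0 ≤ 2 - Y s + L)
    have hMI : ∀ t, t1 ≤ t → M t * I t ≤ Real.exp L * (L + L ^ 2) / 2 := by
      intro t ht
      rcases (hI0 t).eq_or_lt with h0 | h0
      · rw [← h0, mul_zero]; positivity
      have hm0 : 0 < M t * Real.exp (-L) := mul_pos (hMpos t) (Real.exp_pos _)
      have hBp : 0 < (L + L ^ 2) / (2 * (M t * Real.exp (-L))) := by positivity
      have := ode_step Y D M a I I' t (M t * Real.exp (-L)) (L ^ 2)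
        ((L + L ^ 2) / (2 * (M t * Real.exp (-L)))) hY hI hMa hD ha h2 h0 hm0
        (by
          intro s hs
          rw [← Real.log_le_log_iff hm0 (hMpos s), Real.log_mul (hMpos t).ne' (Real.exp_pos _).ne',
            Real.log_exp]
          have e := hLm hs.1
          simp only at e
          have := hs.2
          nlinarith)
        (by
          intro s hs
          have := hYt s (ht.trans hs.1)
          have := hYL s
          nlinarith) hBp
        (by
          apply div_le_div_of_nonneg_right _ (by linarith)
          have := hYL (t + 1)
          have := hYt t ht
          linarith)
      have h4 : 0 < 1 / I (t + 1) := by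
        have : 0 < I (t + 1) := lt_of_lt_of_le h0 (hmono (by simp))
        positivity
      have h5 := one_div_le_one_div_of_le (a := 1 / ((L + L ^ 2) / (2 * (M t * Real.exp (-L))))) (b := 1 / I t)
        (by positivity) (by linarith)
      rw [one_div_one_div, one_div_one_div, le_div_iff₀ (by positivity)] at h5
      have h6 : Real.exp (-L) * Real.exp L = 1 := by rw [← Real.exp_add]; simp
      have h7 := mul_le_mul_of_nonneg_right h5 (Real.exp_pos L).le
      have h8 : I t * (2 * (M t * Real.exp (-L))) * Real.exp L
        = 2 * (M t * I t) * (Real.exp (-L) * Real.exp L) := by ring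
      rw [h8, h6] at h7
      linarith
    set Z : ℝ → ℝ := fun t => M t * (I t - μ * (a t - w t)) with hZ
    have hZ' : ∀ t, HasDerivAt Z ((2 - Y t) * M t * (I t - μ * (a t - w t))
        + M t * (I' t - μ * k' t)) t := fun t =>
      (hM' t).fun_mul ((hI t).fun_sub ((hk t).const_mul μ))
    have hG : MonotoneOn (fun t => Z t + 5 / 4 * μ ^ 2 * Y t - μ ^ 2 * t) (Set.Ici t1) := by
      have hd : ∀ s, HasDerivAt (fun t => Z t + 5 / 4 * μ ^ 2 * Y t - μ ^ 2 * t)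
        ((2 - Y s) * M s * (I s - μ * (a s - w s)) + M s * (I' s - μ * k' s)
          + 5 / 4 * μ ^ 2 * D s - μ ^ 2) s := fun s => by
        simpa using ((hZ' s).fun_add ((hY s).const_mul (5 / 4 * μ ^ 2))).fun_sub
          ((hasDerivAt_id s).const_mul (μ ^ 2))
      apply monotoneOn_of_deriv_nonneg (convex_Ici _)
        (fun s hs => (hd s).continuousAt.continuousWithinAt)
        (fun s hs => (hd s).differentiableAt.differentiableWithinAt)
      intro s hs
      rw [(hd s).deriv]
      have hs : t1 ≤ s := interior_subset hs
      have y1 := hYt s hs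
      have y2 := hYL s
      have y3 : L = 2 * μ + 2 := by rw [hμ]; ring
      have i1 := mul_le_mul_of_nonneg_left (h1 s μ) (hMpos s).le
      have i2 : 0 ≤ M s * I s * (L - Y s) :=
        mul_nonneg (mul_nonneg (hMpos s).le (hI0 s)) (by linarith)
      have ma0 : 0 ≤ M s * a s := mul_nonneg (hMpos s).le (ha s)
      have i3 : M s * a s * (μ / 2) ≤ M s * a s * (Y s - 2 - μ) :=
        mul_le_mul_of_nonneg_left (by linarith) ma0
      have i4 : M s * w s * (Y s - 2) ≤ M s * w s * (2 * μ) :=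
        mul_le_mul_of_nonneg_left (by linarith) (hMw0 s)
      have i5 := hMae s
      have i6 := hMw s
      have i7 : 4 ≤ Y s ^ 2 := by nlinarith
      have j1 : (2 - Y s) * M s * (I s - μ * (a s - w s)) + M s * (I' s - μ * k' s)
          ≥ μ * (M s * a s * (Y s - 2 - μ)) - μ * (M s * w s * (Y s - 2)) := by
        rw [y3] at i2
        nlinarith
      have j2 := mul_le_mul_of_nonneg_left i3 hμp.le
      have j3 := mul_le_mul_of_nonneg_left i4 hμp.le
      have j4 : μ ^ 2 * ((M s * a s) / 2 - 2 * (M s * w s)) ≥ μ ^ 2 * (1 - 5 / 4 * D s) := by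
        apply mul_le_mul_of_nonneg_left _ (sq_nonneg μ)
        linarith
      nlinarith
    set B0 := Real.exp L * (L + L ^ 2) / 2
    obtain ⟨T, hT⟩ : ∃ T : ℝ, B0 + μ * (L / 2) - (Z t1 + 5 / 4 * μ ^ 2 * Y t1 - μ ^ 2 * t1)
        + 5 / 4 * μ ^ 2 * L < μ ^ 2 * T := by
      refine ⟨(B0 + μ * (L / 2) - (Z t1 + 5 / 4 * μ ^ 2 * Y t1 - μ ^ 2 * t1)
        + 5 / 4 * μ ^ 2 * L + 1) / μ ^ 2, ?_⟩
      rw [mul_div_cancel₀ _ (by positivity)]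
      linarith
    set t := max T t1
    obtain ⟨s, hs, hDs⟩ := exists_hasDerivAt_eq_slope Y D (by linarith : t < t + 1)
      (fun s _ => (hY s).continuousAt.continuousWithinAt) (fun s _ => hY s)
    have hts : t1 ≤ s := (le_max_right T t1).trans hs.1.le
    have hDL : D s ≤ L := by
      rw [hDs]
      have := hYL (t + 1)
      have := hYt t (le_max_right T t1)
      have e : t + 1 - t = 1 := by ring
      rw [e, div_one]; linarith
    have g1 := hG (Set.mem_Ici.2 le_rfl) (Set.mem_Ici.2 hts) hts
    simp only at g1
    have g2 : Z s ≤ B0 + μ * (L / 2) := by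
      have e : Z s = M s * I s - μ * (M s * a s) + μ * (M s * w s) := by simp only [hZ]; ring
      rw [e]
      have := hMI s hts
      have m1 : μ * (M s * w s) ≤ μ * (L / 2) :=
        mul_le_mul_of_nonneg_left (by linarith [hMw s]) hμp.le
      have m2 : 0 ≤ μ * (M s * a s) := mul_nonneg hμp.le (mul_nonneg (hMpos s).le (ha s))
      linarith
    have g3 : μ ^ 2 * T ≤ μ ^ 2 * s :=
      mul_le_mul_of_nonneg_left ((le_max_left T t1).trans hs.1.le) (sq_nonneg μ)
    have g4 : 5 / 4 * μ ^ 2 * Y s ≤ 5 / 4 * μ ^ 2 * L :=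
      mul_le_mul_of_nonneg_left (hYL s) (by positivity)
    linarith

/-- Sum of squared gradients. -/
noncomputable def Af (u v : Pl → ℝ) (x : Pl) : ℝ :=
  pd 0 u x ^ 2 + pd 1 u x ^ 2 + (pd 0 v x ^ 2 + pd 1 v x ^ 2)

/-- Interaction density. -/
noncomputable def Wf (u v : Pl → ℝ) (x : Pl) : ℝ := u x ^ 2 * v x ^ 2

lemma grad_sq (u : Pl → ℝ) (x : Pl) :
    Rd u x ^ 2 + Td u x ^ 2 = nsq x * (pd 0 u x ^ 2 + pd 1 u x ^ 2) := by
  rw [Rd_eq, Td_eq, nsq]; ring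

lemma Af_C1 {u v : Pl → ℝ} (hu : ContDiff ℝ 2 u) (hv : ContDiff ℝ 2 v) : ContDiff ℝ 1 (Af u v) :=
  (((pd_C1 hu 0).pow 2).add ((pd_C1 hu 1).pow 2)).add (((pd_C1 hv 0).pow 2).add ((pd_C1 hv 1).pow 2))

lemma Wf_C1 {u v : Pl → ℝ} (hu : ContDiff ℝ 2 u) (hv : ContDiff ℝ 2 v) : ContDiff ℝ 1 (Wf u v) :=
  ((hu.pow 2).mul (hv.pow 2)).of_le (by norm_num)

lemma H_deriv {u v : Pl → ℝ} (hu : ContDiff ℝ 2 u) (hv : ContDiff ℝ 2 v) (t : ℝ) :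
    HasDerivAt (cI (fun x => u x ^ 2 + v x ^ 2))
      (cI (fun x => 2 * u x * Rd u x + 2 * v x * Rd v x) t) t := by
  have hu1 : ContDiff ℝ 1 u := hu.of_le (by norm_num)
  have hv1 : ContDiff ℝ 1 v := hv.of_le (by norm_num)
  refine cI_deriv' (X := fun _ => 0) ((hu1.pow 2).add (hv1.pow 2)) contDiff_const (fun x => ?_) t
  have a := C1_diff hu1 x
  have b := C1_diff hv1 x
  rw [dv_const, dv_add (a.fun_pow 2) (b.fun_pow 2), dv_sq a, dv_sq b]; ring

lemma H1_deriv {u v : Pl → ℝ} (hu : ContDiff ℝ 2 u) (hv : ContDiff ℝ 2 v)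
    (hequ : ∀ x, lapl u x = u x * (v x) ^ 2) (heqv : ∀ x, lapl v x = v x * (u x) ^ 2) (t : ℝ) :
    HasDerivAt (cI (fun x => 2 * u x * Rd u x + 2 * v x * Rd v x))
      (2 * Real.exp (2 * t) * (cI (Af u v) t + 2 * cI (Wf u v) t)) t := by
  have hu1 : ContDiff ℝ 1 u := hu.of_le (by norm_num)
  have hv1 : ContDiff ℝ 1 v := hv.of_le (by norm_num)
  have a := weak0 hu hu1 t
  have b := weak0 hv hv1 t
  have c := (a.const_mul 2).fun_add (b.const_mul 2)
  have hRu := (Rd_C1 hu).continuous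
  have hRv := (Rd_C1 hv).continuous
  have hTu := (Td_C1 hu).continuous
  have hTv := (Td_C1 hv).continuous
  have uc := hu.continuous
  have vc := hv.continuous
  have hA := (Af_C1 hu hv).continuous
  have hW := (Wf_C1 hu hv).continuous
  have nc : Continuous nsq := (nsq_contDiff (n := 0)).continuous
  have e : (cI (fun x => 2 * u x * Rd u x + 2 * v x * Rd v x)) =
      fun t => 2 * cI (fun x => u x * Rd u x) t + 2 * cI (fun x => v x * Rd v x) t := by
    funext t
    rw [← cI_smul, ← cI_smul, ← cI_add (by fun_prop) (by fun_prop)]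
    congr 1; funext x; ring
  rw [e]
  refine c.congr_deriv ?_
  simp only [hequ, heqv]
  rw [← cI_smul, ← cI_smul, ← cI_add (by fun_prop) (by fun_prop), mul_assoc 2, ← cI_smul,
    ← cI_add (by fun_prop) (by fun_prop), ← cI_nsq, ← cI_smul]
  congr 1; funext x
  have g1 := grad_sq u x
  have g2 := grad_sq v x
  simp only [Af, Wf]
  linear_combination 2 * g1 + 2 * g2

/-- Nonnegativity of the Pohozaev quantity. -/
lemma pohozaev {u v : Pl → ℝ} (hu : ContDiff ℝ 2 u) (hv : ContDiff ℝ 2 v)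
    (hequ : ∀ x, lapl u x = u x * (v x) ^ 2) (heqv : ∀ x, lapl v x = v x * (u x) ^ 2) (t : ℝ) :
    0 ≤ cI (fun x => Td u x ^ 2 - Rd u x ^ 2 + (Td v x ^ 2 - Rd v x ^ 2) + nsq x * Wf u v x) t := by
  have hu1 : ContDiff ℝ 1 u := hu.of_le (by norm_num)
  have hv1 : ContDiff ℝ 1 v := hv.of_le (by norm_num)
  have hRu := Rd_C1 hu
  have hRv := Rd_C1 hv
  have hTu := Td_C1 hu
  have hTv := Td_C1 hv
  have hW := Wf_C1 hu hv
  have hn := nsq_contDiff (n := 1)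
  have hF : ContDiff ℝ 1
      (fun x => Td u x ^ 2 - Rd u x ^ 2 + (Td v x ^ 2 - Rd v x ^ 2) + nsq x * Wf u v x) := by
    fun_prop
  refine nonneg_of_deriv hF.continuous ?_ (G := cI (fun x => 2 * (nsq x * Wf u v x)))
    (fun t => cI_deriv' (X := fun x => -2 * (Td u x * Rd u x + Td v x * Rd v x)) hF
      (by fun_prop) (fun x => ?_) t) (cI_nonneg fun x => ?_) t
  · simp [Rd_eq, Td_eq, nsq]
  · have a1 := C1_diff hu1 x
    have a2 := C1_diff hv1 x
    have a3 := C1_diff hRu x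
    have a4 := C1_diff hRv x
    have a5 := C1_diff hTu x
    have a6 := C1_diff hTv x
    have a7 := C1_diff hW x
    have a8 := C1_diff hn x
    have eW : Rd (Wf u v) x = 2 * u x * v x ^ 2 * Rd u x + 2 * v x * u x ^ 2 * Rd v x := by
      have : Rd (Wf u v) x = Rd (fun x => u x ^ 2 * v x ^ 2) x := rfl
      rw [this, dv_mul (a1.fun_pow 2) (a2.fun_pow 2), dv_sq a1, dv_sq a2]; ring
    have en : Rd nsq x = 2 * nsq x := by
      have : Rd nsq x = Rd (fun x => x 0 ^ 2 + x 1 ^ 2) x := rfl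
      have c0 : DifferentiableAt ℝ (fun x : Pl => x 0) x := by fun_prop
      have c1 : DifferentiableAt ℝ (fun x : Pl => x 1) x := by fun_prop
      rw [this, dv_add (c0.fun_pow 2) (c1.fun_pow 2), dv_sq c0, dv_sq c1, dv_coord, dv_coord, nsq]
      simp only [Ef]; ring
    rw [dv_add (by fun_prop) (by fun_prop), dv_add (by fun_prop) (by fun_prop),
      dv_sub (by fun_prop) (by fun_prop), dv_sub (by fun_prop) (by fun_prop),
      dv_sq a3, dv_sq a4, dv_sq a5, dv_sq a6, dv_mul a8 a7, eW, en,
      dv_mul (by fun_prop) (by fun_prop), dv_const, dv_add (by fun_prop) (by fun_prop),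
      dv_mul a5 a3, dv_mul a6 a4]
    have s1 := second_order hu x
    have s2 := second_order hv x
    rw [hequ] at s1
    rw [heqv] at s2
    rw [s1.1, s2.1]
    linear_combination (-2 * Rd u x) * s1.2 + (-2 * Rd v x) * s2.2
  · simp only [Wf, nsq]; positivity

lemma H_cs {u v : Pl → ℝ} (hu : ContDiff ℝ 2 u) (hv : ContDiff ℝ 2 v) (hup : ∀ x, 0 < u x)
    (hequ : ∀ x, lapl u x = u x * (v x) ^ 2) (heqv : ∀ x, lapl v x = v x * (u x) ^ 2) (t : ℝ) :
    cI (fun x => 2 * u x * Rd u x + 2 * v x * Rd v x) t ^ 2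
      ≤ cI (fun x => u x ^ 2 + v x ^ 2) t * (2 * Real.exp (2 * t) * (cI (Af u v) t
        + 2 * cI (Wf u v) t) - 2 * Real.exp (2 * t) * cI (Wf u v) t) := by
  have uc := hu.continuous
  have vc := hv.continuous
  have hRu := (Rd_C1 hu).continuous
  have hRv := (Rd_C1 hv).continuous
  have hTu := (Td_C1 hu).continuous
  have hTv := (Td_C1 hv).continuous
  have hA := (Af_C1 hu hv).continuous
  have hW := (Wf_C1 hu hv).continuous
  have nc : Continuous nsq := (nsq_contDiff (n := 0)).continuous
  set H := cI (fun x => u x ^ 2 + v x ^ 2) t with hH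
  set H1 := cI (fun x => 2 * u x * Rd u x + 2 * v x * Rd v x) t with hH1
  set ρ := cI (fun x => Rd u x ^ 2 + Rd v x ^ 2) t with hρ
  have Hpos : 0 < H := cI_pos (by fun_prop) (fun x => by have := hup x; positivity) t
  have q : ∀ l : ℝ, 0 ≤ ρ - l * H1 + l ^ 2 * H := by
    intro l
    rw [hρ, hH1, hH, ← cI_smul, ← cI_smul, ← cI_sub (by fun_prop) (by fun_prop),
      ← cI_add (by fun_prop) (by fun_prop)]
    refine cI_nonneg (fun x => ?_) t
    nlinarith [sq_nonneg (Rd u x - l * u x), sq_nonneg (Rd v x - l * v x)]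
  have cs : H1 ^ 2 ≤ 4 * H * ρ := by
    have := q (H1 / (2 * H))
    have e : ρ - H1 / (2 * H) * H1 + (H1 / (2 * H)) ^ 2 * H = (4 * H * ρ - H1 ^ 2) / (4 * H) := by
      field_simp; ring
    rw [e] at this
    have h2 := mul_nonneg this (by positivity : 0 ≤ 4 * H)
    rw [div_mul_cancel₀ _ (by positivity)] at h2
    linarith
  have po := pohozaev hu hv hequ heqv t
  have e2 : cI (fun x => Td u x ^ 2 - Rd u x ^ 2 + (Td v x ^ 2 - Rd v x ^ 2) + nsq x * Wf u v x) t
      = Real.exp (2 * t) * cI (Af u v) t - 2 * ρ + Real.exp (2 * t) * cI (Wf u v) t := by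
    rw [← cI_nsq, ← cI_nsq, hρ, ← cI_smul, ← cI_sub (by fun_prop) (by fun_prop),
      ← cI_add (by fun_prop) (by fun_prop)]
    congr 1; funext x
    have g1 := grad_sq u x
    have g2 := grad_sq v x
    simp only [Af]
    linear_combination g1 + g2
  rw [e2] at po
  nlinarith

/-- Derivative of the gradient energy minus interaction. -/
lemma kappa_deriv {u v : Pl → ℝ} (hu : ContDiff ℝ 2 u) (hv : ContDiff ℝ 2 v)
    (hq : ∀ x, pd 1 u x ≠ 0) (hn : ∀ x, pd 1 v x ≠ 0)
    (hequ : ∀ x, lapl u x = u x * (v x) ^ 2) (heqv : ∀ x, lapl v x = v x * (u x) ^ 2) (t : ℝ) :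
    HasDerivAt (fun t => cI (Af u v) t - cI (Wf u v) t)
      (cI (fun x => 2 * (pd 1 u x * Gv Jf u x + pd 1 v x * Gv Jf v x)) t) t := by
  have hu1 : ContDiff ℝ 1 u := hu.of_le (by norm_num)
  have hv1 : ContDiff ℝ 1 v := hv.of_le (by norm_num)
  have hA := Af_C1 hu hv
  have hW := Wf_C1 hu hv
  refine ((cI_deriv hA t).fun_sub (cI_deriv hW t)).congr_deriv ?_
  rw [← cI_sub (Rd_C0 hA) (Rd_C0 hW)]
  congr 1; funext x
  have a1 := C1_diff hu1 x
  have a2 := C1_diff hv1 x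
  have eW : Rd (Wf u v) x = 2 * u x * v x ^ 2 * Rd u x + 2 * v x * u x ^ 2 * Rd v x := by
    have : Rd (Wf u v) x = Rd (fun x => u x ^ 2 * v x ^ 2) x := rfl
    rw [this, dv_mul (a1.fun_pow 2) (a2.fun_pow 2), dv_sq a1, dv_sq a2]; ring
  have b1 := C1_diff (pd_C1 hu 0) x
  have b2 := C1_diff (pd_C1 hu 1) x
  have b3 := C1_diff (pd_C1 hv 0) x
  have b4 := C1_diff (pd_C1 hv 1) x
  have eA : Rd (Af u v) x = 2 * pd 0 u x * Rd (pd 0 u) x + 2 * pd 1 u x * Rd (pd 1 u) x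
      + (2 * pd 0 v x * Rd (pd 0 v) x + 2 * pd 1 v x * Rd (pd 1 v) x) := by
    have : Rd (Af u v) x = Rd (fun x => pd 0 u x ^ 2 + pd 1 u x ^ 2
      + (pd 0 v x ^ 2 + pd 1 v x ^ 2)) x := rfl
    rw [this, dv_add (by fun_prop) (by fun_prop), dv_add (by fun_prop) (by fun_prop),
      dv_add (by fun_prop) (by fun_prop), dv_sq b1, dv_sq b2, dv_sq b3, dv_sq b4]
  have key : ∀ g : Pl → ℝ, ContDiff ℝ 2 g → pd 1 g x ≠ 0 → pd 1 g x * Gv Jf g x =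
      pd 0 g x * Rd (pd 0 g) x + pd 1 g x * Rd (pd 1 g) x - lapl g x * Rd g x := by
    intro g hg h0
    have e : pd 1 g x * Gv Jf g x = pd 1 g x * Td (pd 0 g) x - pd 0 g x * Td (pd 1 g) x := by
      simp only [Gv, sg]; field_simp
    rw [e, lapl_eq, Td_eq, Td_eq, Rd_eq, Rd_eq, Rd_eq, pd_comm hg x 0 1]
    ring
  rw [key u hu (hq x), key v hv (hn x), eA, eW, hequ, heqv]
  ring

lemma H_growth {u v : Pl → ℝ} (hu : ContDiff ℝ 2 u) (hv : ContDiff ℝ 2 v)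
    (hup : ∀ x, 0 < u x) (hvp : ∀ x, 0 < v x) (C α : ℝ) (hC : 0 < C) (hα : 1 ≤ α)
    (hg : ∀ x : Pl, u x + v x ≤ C * (1 + ‖x‖) ^ α) :
    ∃ c b : ℝ, ∀ t, 0 ≤ t → cI (fun x => u x ^ 2 + v x ^ 2) t ≤ Real.exp (c + b * t) := by
  refine ⟨Real.log (2 * Real.pi) + 2 * (Real.log C + α * Real.log 2), 2 * α, fun t ht => ?_⟩
  have uc := hu.continuous
  have vc := hv.continuous
  set B := Real.exp (Real.log C + α * (Real.log 2 + t)) with hB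
  have pt : ∀ θ, u (Pp t θ) ^ 2 + v (Pp t θ) ^ 2 ≤ B ^ 2 := by
    intro θ
    have nP : ‖Pp t θ‖ = Real.exp t := by
      rw [EuclideanSpace.norm_eq, Fin.sum_univ_two, Real.norm_eq_abs, Real.norm_eq_abs, sq_abs, sq_abs]
      have := Pp_nsq t θ
      unfold nsq at this
      rw [this, show 2 * t = t + t by ring, Real.exp_add, Real.sqrt_mul_self (Real.exp_pos t).le]
    have h1 := hg (Pp t θ)
    rw [nP] at h1
    have h2 : (1 + Real.exp t) ^ α ≤ Real.exp (α * (Real.log 2 + t)) := by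
      have : Real.exp (α * (Real.log 2 + t)) = (2 * Real.exp t) ^ α := by
        rw [mul_comm α, Real.exp_mul, Real.exp_add, Real.exp_log (by norm_num)]
      rw [this]
      apply Real.rpow_le_rpow (by positivity) _ (by linarith)
      have := Real.one_le_exp ht
      linarith
    have h3 : u (Pp t θ) + v (Pp t θ) ≤ B := by
      rw [hB, Real.exp_add, Real.exp_log hC]
      exact h1.trans (mul_le_mul_of_nonneg_left h2 hC.le)
    have := hup (Pp t θ)
    have := hvp (Pp t θ)
    nlinarith
  have : cI (fun x => u x ^ 2 + v x ^ 2) t ≤ ∫ _ in (0:ℝ)..(2 * Real.pi), B ^ 2 :=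
    intervalIntegral.integral_mono_on (by positivity)
      (cI_ii (F := fun x => u x ^ 2 + v x ^ 2) (by fun_prop) t _ _) intervalIntegrable_const (fun θ _ => pt θ)
  rw [intervalIntegral.integral_const, smul_eq_mul, sub_zero] at this
  refine this.trans (le_of_eq ?_)
  rw [hB, pow_two, ← Real.exp_add]
  conv_lhs => rw [← Real.exp_log (by positivity : 0 < 2 * Real.pi)]
  rw [← Real.exp_add]
  congr 1; ring

/-- Derivative of the total boundary term. -/
noncomputable def Df (u v : Pl → ℝ) (x : Pl) : ℝ :=
  Gv Ef u x ^ 2 + Gv Jf u x ^ 2 + (Gv Ef v x ^ 2 + Gv Jf v x ^ 2)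
    + nsq x * (-2 * (u x * v x * (pd 1 u x * pd 1 v x)) * (sg u x - sg v x) ^ 2)

lemma pd_source {u v : Pl → ℝ} (hu : ContDiff ℝ 2 u) (hv : ContDiff ℝ 2 v) (j : Fin 2) (x : Pl) :
    pd j (fun x => u x * v x ^ 2) x = v x ^ 2 * pd j u x + 2 * u x * v x * pd j v x := by
  have a := C1_diff (hu.of_le (by norm_num)) x
  have b := C1_diff (hv.of_le (by norm_num)) x
  rw [dv_mul a (b.fun_pow 2), dv_sq b]; ring

lemma slope_const (u v : Pl → ℝ)
    (hu : ContDiff ℝ 2 u) (hv : ContDiff ℝ 2 v)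
    (hequ : ∀ x, lapl u x = u x * (v x) ^ 2)
    (heqv : ∀ x, lapl v x = v x * (u x) ^ 2)
    (hup : ∀ x, 0 < u x) (hvp : ∀ x, 0 < v x)
    (hq : ∀ x, 0 < pd 1 u x) (hn : ∀ x, pd 1 v x < 0)
    (C α : ℝ) (hC : 0 < C) (hα : 1 ≤ α)
    (hgrowth : ∀ x : Pl, u x + v x ≤ C * (1 + ‖x‖) ^ α) :
    ∃ c : ℝ, ∀ x, pd 0 u x = c * pd 1 u x ∧ pd 0 v x = c * pd 1 v x := by
  have hq0 : ∀ x, pd 1 u x ≠ 0 := fun x => (hq x).ne'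
  have hn0 : ∀ x, pd 1 v x ≠ 0 := fun x => (hn x).ne
  have uc := hu.continuous
  have vc := hv.continuous
  have p0 := (pd_C1 hu 0).continuous
  have p1 := (pd_C1 hu 1).continuous
  have m0 := (pd_C1 hv 0).continuous
  have m1 := (pd_C1 hv 1).continuous
  have su := (sg_C1 hu hq0).continuous
  have sv := (sg_C1 hv hn0).continuous
  have Jc : Continuous Jf := (Jf_contDiff (n := 0)).continuous
  have g1 := Gv_cont hu hq0 (V := Ef) continuous_id
  have g2 := Gv_cont hu hq0 Jc
  have g3 := Gv_cont hv hn0 (V := Ef) continuous_id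
  have g4 := Gv_cont hv hn0 Jc
  have nc : Continuous nsq := (nsq_contDiff (n := 0)).continuous
  have hA := (Af_C1 hu hv).continuous
  have i1 := Iu_cont hu hq0
  have i2 := Iu_cont hv hn0
  have dc : Continuous (Df u v) := by unfold Df; fun_prop
  have hlast : ∀ x, 0 ≤ -2 * (u x * v x * (pd 1 u x * pd 1 v x)) := by
    intro x
    have a1 := mul_pos (hup x) (hvp x)
    have a2 := mul_neg_of_pos_of_neg (hq x) (hn x)
    have := mul_neg_of_pos_of_neg a1 a2
    linarith
  have nn : ∀ x, 0 ≤ nsq x := fun x => by unfold nsq; positivity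
  have hlast2 : ∀ x, 0 ≤ nsq x * (-2 * (u x * v x * (pd 1 u x * pd 1 v x))
      * (sg u x - sg v x) ^ 2) := fun x =>
    mul_nonneg (nn x) (mul_nonneg (hlast x) (sq_nonneg _))
  have hD0 : ∀ x, 0 ≤ Df u v x := by
    intro x
    have := hlast2 x
    unfold Df; positivity
  -- derivative of I
  have hI : ∀ t, HasDerivAt (cI (fun x => Iu u x + Iu v x)) (cI (Df u v) t) t := by
    intro t
    have fu : ContDiff ℝ 1 (fun x => u x * v x ^ 2) := (hu.mul (hv.pow 2)).of_le (by norm_num)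
    have fv : ContDiff ℝ 1 (fun x => v x * u x ^ 2) := (hv.mul (hu.pow 2)).of_le (by norm_num)
    have d := (Iu_deriv hu hq0 fu hequ t).fun_add (Iu_deriv hv hn0 fv heqv t)
    have e : (cI (fun x => Iu u x + Iu v x)) = fun t => cI (Iu u) t + cI (Iu v) t :=
      funext fun t => cI_add i1 i2 t
    rw [e]
    refine d.congr_deriv ?_
    have c1 := pd_C0 fu 0
    have c2 := pd_C0 fu 1
    have c3 := pd_C0 fv 0
    have c4 := pd_C0 fv 1
    rw [← cI_add (by fun_prop) (by fun_prop)]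
    congr 1; funext x
    rw [pd_source hu hv, pd_source hu hv, pd_source hv hu, pd_source hv hu]
    have a1 := hq0 x
    have a2 := hn0 x
    simp only [Df, sg]
    field_simp
    ring
  have hI0 : ∀ t, 0 ≤ cI (fun x => Iu u x + Iu v x) t := by
    refine nonneg_of_deriv (by fun_prop) ?_ hI (cI_nonneg hD0)
    have : ∀ g : Pl → ℝ, Iu g 0 = 0 := by
      intro g
      simp only [Iu, Gv, Rd_eq]; simp
    simp [this]
  have key1 : ∀ g : Pl → ℝ, ∀ x l, 2 * l * Iu g x + l * (2 * (pd 1 g x * Gv Jf g x))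
      - l ^ 2 * (pd 0 g x ^ 2 + pd 1 g x ^ 2) ≤ Gv Ef g x ^ 2 + Gv Jf g x ^ 2 := by
    intro g x l
    simp only [Iu]
    nlinarith [sq_nonneg (Gv Ef g x - l * pd 0 g x), sq_nonneg (Gv Jf g x - l * pd 1 g x)]
  have key2 : ∀ g : Pl → ℝ, ∀ x l, 2 * l * Iu g x
      - l ^ 2 * (pd 0 g x ^ 2 + pd 1 g x ^ 2) ≤ Gv Ef g x ^ 2 + Gv Jf g x ^ 2 := by
    intro g x l
    simp only [Iu]
    nlinarith [sq_nonneg (Gv Ef g x - l * pd 0 g x), sq_nonneg (Gv Jf g x), sq_nonneg (l * pd 1 g x)]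
  obtain ⟨c, b, hgr⟩ := H_growth hu hv hup hvp C α hC hα hgrowth
  have hzero := ode_main (cI (fun x => u x ^ 2 + v x ^ 2))
    (cI (fun x => 2 * u x * Rd u x + 2 * v x * Rd v x))
    (fun t => 2 * Real.exp (2 * t) * (cI (Af u v) t + 2 * cI (Wf u v) t))
    (cI (Af u v)) (cI (Wf u v)) (cI (fun x => Iu u x + Iu v x)) (cI (Df u v))
    (cI (fun x => 2 * (pd 1 u x * Gv Jf u x + pd 1 v x * Gv Jf v x)))
    (H_deriv hu hv) (H1_deriv hu hv hequ heqv)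
    (cI_pos (by fun_prop) (fun x => by have := hup x; positivity))
    (fun _ => rfl) (H_cs hu hv hup hequ heqv)
    (cI_nonneg fun x => by unfold Af; positivity) (cI_nonneg fun x => by unfold Wf; positivity)
    hI (kappa_deriv hu hv hq0 hn0 hequ heqv)
    (by
      intro t l
      rw [← cI_smul, ← cI_smul, ← cI_smul, ← cI_add (by fun_prop) (by fun_prop),
        ← cI_sub (by fun_prop) (by fun_prop)]
      refine cI_mono (by fun_prop) dc (fun x => ?_) t
      have := key1 u x l
      have := key1 v x l
      have := hlast2 x
      simp only [Df, Af]
      linarith)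
    (by
      intro t l
      rw [← cI_smul, ← cI_smul, ← cI_sub (by fun_prop) (by fun_prop)]
      refine cI_mono (by fun_prop) dc (fun x => ?_) t
      have := key2 u x l
      have := key2 v x l
      have := hlast2 x
      simp only [Df, Af]
      linarith)
    hI0 c b hgr
  have hDz : ∀ t, cI (Df u v) t = 0 := by
    intro t
    have e : (cI (fun x => Iu u x + Iu v x)) = fun _ => 0 := funext hzero
    have h := hI t
    rw [e] at h
    exact h.unique (hasDerivAt_const t 0)
  have hDzero := cI_zero dc hD0 hDz
  -- consequences away from the origin
  have hnpos : ∀ x : Pl, x ≠ 0 → 0 < nsq x := by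
    intro x hx
    refine lt_of_le_of_ne (nn x) (fun h => hx ?_)
    unfold nsq at h
    have h0 : x 0 = 0 := by nlinarith [sq_nonneg (x 0), sq_nonneg (x 1)]
    have h1 : x 1 = 0 := by nlinarith [sq_nonneg (x 0), sq_nonneg (x 1)]
    ext i; fin_cases i <;> simp [h0, h1]
  have cons : ∀ x : Pl, x ≠ 0 → Gv Ef u x = 0 ∧ Gv Jf u x = 0 ∧ sg v x = sg u x := by
    intro x hx
    have h := hDzero x hx
    have l2 := hlast2 x
    unfold Df at h
    refine ⟨?_, ?_, ?_⟩
    · nlinarith [sq_nonneg (Gv Ef u x), sq_nonneg (Gv Jf u x), sq_nonneg (Gv Ef v x), sq_nonneg (Gv Jf v x)]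
    · nlinarith [sq_nonneg (Gv Ef u x), sq_nonneg (Gv Jf u x), sq_nonneg (Gv Ef v x), sq_nonneg (Gv Jf v x)]
    · have z : nsq x * (-2 * (u x * v x * (pd 1 u x * pd 1 v x)) * (sg u x - sg v x) ^ 2) = 0 := by
        nlinarith [sq_nonneg (Gv Ef u x), sq_nonneg (Gv Jf u x), sq_nonneg (Gv Ef v x), sq_nonneg (Gv Jf v x)]
      have := hnpos x hx
      have hne : -2 * (u x * v x * (pd 1 u x * pd 1 v x)) ≠ 0 := by
        have := hup x
        have := hvp x
        have := hq0 x
        have := hn0 x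
        simp; refine ⟨⟨?_, ?_⟩, ?_, ?_⟩ <;> first | assumption | positivity
      rcases mul_eq_zero.1 z with z | z
      · linarith
      rcases mul_eq_zero.1 z with z | z
      · exact absurd z hne
      have := pow_eq_zero_iff (two_ne_zero) |>.1 z
      linarith
  have hsC := sg_C1 hu hq0
  have hpd : ∀ x : Pl, x ≠ 0 → pd 0 (sg u) x = 0 ∧ pd 1 (sg u) x = 0 := by
    intro x hx
    obtain ⟨h1, h2, -⟩ := cons x hx
    have e1 := dv_sg hu hq0 Ef x
    have e2 := dv_sg hu hq0 Jf x
    rw [h1, zero_div, Rd_eq] at e1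
    rw [h2, zero_div, Td_eq] at e2
    have hp := hnpos x hx
    constructor
    · have : nsq x * pd 0 (sg u) x = 0 := by
        unfold nsq; linear_combination x 0 * e1 - x 1 * e2
      exact (mul_eq_zero.1 this).resolve_left hp.ne'
    · have : nsq x * pd 1 (sg u) x = 0 := by
        unfold nsq; linear_combination x 1 * e1 + x 0 * e2
      exact (mul_eq_zero.1 this).resolve_left hp.ne'
  have hpd0 : ∀ x : Pl, pd 0 (sg u) x = 0 :=
    eq_of_ne_zero (pd_C0 hsC 0) continuous_const (fun x hx => (hpd x hx).1)
  have hpd1 : ∀ x : Pl, pd 1 (sg u) x = 0 :=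
    eq_of_ne_zero (pd_C0 hsC 1) continuous_const (fun x hx => (hpd x hx).2)
  have hconst : ∀ x, sg u x = sg u 0 := by
    intro x
    refine is_const_of_fderiv_eq_zero (𝕜 := ℝ) (hsC.differentiable (by norm_num)) (fun y => ?_) x 0
    ext z
    have : dv (fun _ => z) (sg u) y = 0 := by rw [dv_eq, hpd0, hpd1]; simp
    exact this
  have hsv : ∀ x, sg v x = sg u x := eq_of_ne_zero sv su (fun x hx => (cons x hx).2.2)
  refine ⟨sg u 0, fun x => ⟨?_, ?_⟩⟩
  · rw [← hconst x, sg, div_mul_cancel₀ _ (hq0 x)]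
  · rw [← hconst x, ← hsv x, sg, div_mul_cancel₀ _ (hn0 x)]

/-- **Theorem 1.1 (monotone solutions).** Any monotone solution of
`Δu = u v²`, `Δv = v u²`, `u, v > 0` on `ℝ²` with arbitrary algebraic growth at infinity
is one dimensional. -/
theorem monotone_solution_one_dimensional
    (u v : EuclideanSpace ℝ (Fin 2) → ℝ)
    (hu : ContDiff ℝ 2 u) (hv : ContDiff ℝ 2 v)
    (hequ : ∀ x, lapl u x = u x * (v x) ^ 2)
    (heqv : ∀ x, lapl v x = v x * (u x) ^ 2)
    (hupos : ∀ x, 0 < u x) (hvpos : ∀ x, 0 < v x)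
    (hmonu : ∀ x, 0 < fderiv ℝ u x (EuclideanSpace.single 1 1))
    (hmonv : ∀ x, fderiv ℝ v x (EuclideanSpace.single 1 1) < 0)
    (C α : ℝ) (hC : 0 < C) (hα : 1 ≤ α)
    (hgrowth : ∀ x, u x + v x ≤ C * (1 + ‖x‖) ^ α) :
    ∃ (U V : ℝ → ℝ) (ν : EuclideanSpace ℝ (Fin 2)), ‖ν‖ = 1 ∧
      ∀ x, u x = U ⟪ν, x⟫ ∧ v x = V ⟪ν, x⟫ := by
  obtain ⟨c, hc⟩ := slope_const u v hu hv hequ heqv hupos hvpos hmonu hmonv C α hC hα hgrowth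
  have hu1 : ContDiff ℝ 1 u := hu.of_le (by norm_num)
  have hv1 : ContDiff ℝ 1 v := hv.of_le (by norm_num)
  set m : ℝ := Real.sqrt (c ^ 2 + 1) with hm
  have hm2 : m * m = c ^ 2 + 1 := Real.mul_self_sqrt (by positivity)
  have hmp : 0 < m := Real.sqrt_pos.2 (by positivity)
  set ν : Pl := !₂[c / m, 1 / m] with hν
  have ν0 : ν 0 = c / m := by simp [hν]
  have ν1 : ν 1 = 1 / m := by simp [hν]
  have hdec : ∀ x : Pl, x = ⟪ν, x⟫ • ν + ((x 0 - c * x 1) / (c ^ 2 + 1)) • (!₂[1, -c] : Pl) := by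
    intro x
    have hin : ⟪ν, x⟫ = (c * x 0 + x 1) / m := by
      simp only [PiLp.inner_apply, Fin.sum_univ_two, ν0, ν1]
      simp
      field_simp
    have hp : c ^ 2 + 1 ≠ 0 := by positivity
    have h2 : m ^ 2 = c ^ 2 + 1 := by rw [pow_two]; exact hm2
    ext i
    fin_cases i
    · simp only [hin, Fin.zero_eta, PiLp.add_apply, PiLp.smul_apply, ν0, smul_eq_mul]
      simp
      field_simp
      rw [h2]; ring
    · simp only [hin, Fin.mk_one, PiLp.add_apply, PiLp.smul_apply, ν1, smul_eq_mul]
      simp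
      field_simp
      rw [h2]; ring
  refine ⟨fun s => u (s • ν), fun s => v (s • ν), ν, ?_, fun x => ⟨?_, ?_⟩⟩
  · rw [EuclideanSpace.norm_eq, Fin.sum_univ_two, ν0, ν1, Real.norm_eq_abs, Real.norm_eq_abs,
      sq_abs, sq_abs]
    rw [Real.sqrt_eq_one]
    field_simp
    rw [pow_two m, hm2]
  · have := one_dim hu1 c (fun y => (hc y).1) (⟪ν, x⟫ • ν) ((x 0 - c * x 1) / (c ^ 2 + 1))
    rw [← hdec x] at this
    exact this
  · have := one_dim hv1 c (fun y => (hc y).2) (⟪ν, x⟫ • ν) ((x 0 - c * x 1) / (c ^ 2 + 1))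
    rw [← hdec x] at this
    exact this
end

section
/- Let N ≥ 1 and let v, σ ∈ C²(ℝ^N) be functions such that v > 0 everywhere on ℝ^N, the differential inequality −div(v² ∇σ) ≤ 0 holds on ℝ^N, and there exists a constant C > 0 such that ∫_{B_R(0)} (v σ⁺)² dx ≤ C R² for all sufficiently large R. Then σ⁺ is constant on ℝ^N. -/
open MeasureTheory Metric Filter

/-- The divergence of a vector field `F : ℝᴺ → ℝᴺ`, as the sum of the partial
derivatives of its components. -/
noncomputable def dvg {N : ℕ} (F : EuclideanSpace ℝ (Fin N) → EuclideanSpace ℝ (Fin N))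
    (x : EuclideanSpace ℝ (Fin N)) : ℝ :=
  ∑ i, fderiv ℝ (fun y => F y i) x (EuclideanSpace.single i 1)

/-- Derivative of the truncation function. -/
noncomputable def lvq (t : ℝ) : ℝ := min (max t 0) 1

/-- The convex truncation function. -/
noncomputable def lvp (s : ℝ) : ℝ := ∫ t in (0:ℝ)..s, lvq t

lemma lvq_cont : Continuous lvq := by unfold lvq; fun_prop

lemma lvq_nonneg (t : ℝ) : 0 ≤ lvq t := le_min (le_max_right _ _) zero_le_one

lemma lvq_le_one (t : ℝ) : lvq t ≤ 1 := min_le_right _ _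

lemma lvq_mono : Monotone lvq := fun a b h => by unfold lvq; gcongr

lemma lvq_pos {t : ℝ} (h : 0 < t) : 0 < lvq t :=
  lt_min (lt_of_lt_of_le h (le_max_left _ _)) one_pos

lemma lvp_hasDerivAt (s : ℝ) : HasDerivAt lvp (lvq s) s :=
  (lvq_cont.integral_hasStrictDerivAt 0 s).hasDerivAt

lemma lvp_contDiff : ContDiff ℝ 1 lvp := by
  rw [contDiff_one_iff_deriv]
  refine ⟨fun s => (lvp_hasDerivAt s).differentiableAt, ?_⟩
  have : deriv lvp = lvq := funext fun s => (lvp_hasDerivAt s).deriv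
  rw [this]; exact lvq_cont

lemma lvp_zero : lvp 0 = 0 := by simp [lvp]

lemma lvp_of_nonpos {s : ℝ} (hs : s ≤ 0) : lvp s = 0 := by
  unfold lvp
  rw [intervalIntegral.integral_symm]
  rw [intervalIntegral.integral_congr (g := fun _ => (0:ℝ))]
  · simp
  · intro t ht
    rw [Set.uIcc_of_le hs] at ht
    simp [lvq, ht.2]

lemma lvp_max (s : ℝ) : lvp (max s 0) = lvp s := by
  rcases le_total s 0 with h | h
  · rw [max_eq_right h, lvp_zero, lvp_of_nonpos h]
  · rw [max_eq_left h]

lemma lvp_nonneg (s : ℝ) : 0 ≤ lvp s := by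
  rcases le_total s 0 with h | h
  · rw [lvp_of_nonpos h]
  · exact intervalIntegral.integral_nonneg h fun t _ => lvq_nonneg t

lemma lvp_le (s : ℝ) : lvp s ≤ max s 0 * lvq s := by
  rcases le_total s 0 with h | h
  · rw [lvp_of_nonpos h, max_eq_right h]; simp
  · rw [max_eq_left h]
    have := intervalIntegral.integral_mono_on (μ := volume) h
      (lvq_cont.intervalIntegrable 0 s) (continuous_const.intervalIntegrable (μ := volume) 0 s)
      (fun t ht => lvq_mono ht.2)
    simpa [lvp] using this

lemma lvp_strictMonoOn : StrictMonoOn lvp (Set.Ici 0) := by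
  apply strictMonoOn_of_deriv_pos (convex_Ici 0) lvp_contDiff.continuous.continuousOn
  intro x hx
  rw [interior_Ici] at hx
  rw [(lvp_hasDerivAt x).deriv]
  exact lvq_pos hx

lemma lv_parts {N : ℕ} (φ : EuclideanSpace ℝ (Fin N) → ℝ)
    (F : EuclideanSpace ℝ (Fin N) → EuclideanSpace ℝ (Fin N))
    (hφ : ContDiff ℝ 1 φ) (hc : HasCompactSupport φ) (hF : ContDiff ℝ 1 F) :
    ∫ x, φ x * dvg F x = - ∫ x, fderiv ℝ φ x (F x) := by
  have hFi : ∀ i, ContDiff ℝ 1 (fun y => F y i) := fun i => by fun_prop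
  have hφ' : Continuous (fderiv ℝ φ) := hφ.continuous_fderiv (by norm_num)
  have hFi' : ∀ i, Continuous (fderiv ℝ (fun y => F y i)) :=
    fun i => (hFi i).continuous_fderiv (by norm_num)
  have hφc := hφ.continuous
  have i1 : ∀ i, Integrable (fun x => φ x *
      fderiv ℝ (fun y => F y i) x (EuclideanSpace.single i 1)) := fun i => by
    apply Continuous.integrable_of_hasCompactSupport
    · have := hFi' i
      fun_prop
    · exact hc.mul_right
  have i2 : ∀ i, Integrable (fun x => fderiv ℝ φ x (EuclideanSpace.single i 1) * F x i) :=
    fun i => by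
      apply Continuous.integrable_of_hasCompactSupport
      · have := (hFi i).continuous
        fun_prop
      · exact (hc.fderiv_apply (𝕜 := ℝ) _).mul_right
  have i3 : ∀ i, Integrable (fun x => φ x * F x i) := fun i => by
    apply Continuous.integrable_of_hasCompactSupport
    · have := (hFi i).continuous
      fun_prop
    · exact hc.mul_right
  have e1 : ∀ x, φ x * dvg F x =
      ∑ i, φ x * fderiv ℝ (fun y => F y i) x (EuclideanSpace.single i 1) := fun x => by
    rw [dvg, Finset.mul_sum]
  have e2 : ∀ x, fderiv ℝ φ x (F x) =
      ∑ i, fderiv ℝ φ x (EuclideanSpace.single i 1) * F x i := fun x => by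
    have h : F x = ∑ i, F x i • EuclideanSpace.single i (1:ℝ) := by
      have := (EuclideanSpace.basisFun (Fin N) ℝ).sum_repr (F x)
      simpa using this.symm
    conv_lhs => rw [h]
    rw [map_sum]
    refine Finset.sum_congr rfl fun i _ => ?_
    rw [map_smul, smul_eq_mul, mul_comm]
  simp_rw [e1, e2]
  rw [integral_finsetSum _ (fun i _ => i1 i), integral_finsetSum _ (fun i _ => i2 i),
    ← Finset.sum_neg_distrib]
  refine Finset.sum_congr rfl fun i _ => ?_
  exact integral_mul_fderiv_eq_neg_fderiv_mul_of_integrable (i2 i) (i1 i) (i3 i)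
    (fun x _ => (hφ.differentiable (by norm_num)) x)
    (fun x _ => ((hFi i).differentiable (by norm_num)) x)

lemma lv_growth (a : ℝ → ℝ) (M R0 : ℝ) (hM : 0 ≤ M) (hmono : Monotone a)
    (hb : ∀ R ≥ R0, a R ≤ 4 * M)
    (h : ∀ R ≥ R0, ∀ ε > 0, a R ≤ ε * (a (2 * R) - a R) + M / ε) (R : ℝ) : a R ≤ 0 := by
  have hbdd : BddAbove (Set.range a) := by
    refine ⟨4 * M, ?_⟩
    rintro _ ⟨r, rfl⟩
    exact (hmono (le_max_left r R0)).trans (hb _ (le_max_right r R0))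
  have hL := tendsto_atTop_ciSup hmono hbdd
  set L := ⨆ r, a r with hLdef
  refine (le_ciSup hbdd R).trans ?_
  have hL2 : Tendsto (fun r => a (2 * r)) atTop (nhds L) :=
    hL.comp (tendsto_id.const_mul_atTop (by norm_num : (0:ℝ) < 2))
  have key : ∀ ε > 0, L ≤ ε * (L - L) + M / ε := fun ε hε =>
    le_of_tendsto_of_tendsto hL (((hL2.sub hL).const_mul ε).add_const _)
      ((eventually_ge_atTop R0).mono fun r hr => h r hr ε hε)
  by_contra hcon
  push Not at hcon
  have hLpos : 0 < L := hcon
  have := key ((M + 1) / L) (by positivity)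
  rw [sub_self, mul_zero, zero_add, le_div_iff₀ (by positivity), mul_div_cancel₀ _ hLpos.ne'] at this
  linarith

lemma lv_cutoff (N : ℕ) : ∃ K : ℝ, ∀ R : ℝ, 0 < R → ∃ η : EuclideanSpace ℝ (Fin N) → ℝ,
    ContDiff ℝ 1 η ∧ HasCompactSupport η ∧ (∀ x, 0 ≤ η x) ∧ (∀ x, η x ≤ 1) ∧
    (∀ x ∈ ball 0 R, η x = 1) ∧ (∀ x ∈ ball 0 R, fderiv ℝ η x = 0) ∧
    (∀ x ∉ ball 0 (2 * R), η x = 0) ∧ ∀ x, ‖fderiv ℝ η x‖ ≤ K / R := by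
  let f : ContDiffBump (0 : EuclideanSpace ℝ (Fin N)) := ⟨1, 2, one_pos, one_lt_two⟩
  have hf1 : ContDiff ℝ 1 f := f.contDiff
  obtain ⟨K, hK⟩ := (f.hasCompactSupport.fderiv (𝕜 := ℝ)).exists_bound_of_continuous
    (hf1.continuous_fderiv (by norm_num))
  refine ⟨K, fun R hR => ⟨fun x => f (R⁻¹ • x), ?_, ?_, fun x => f.nonneg, fun x => f.le_one,
    ?_, ?_, ?_, ?_⟩⟩
  · exact hf1.comp (contDiff_const_smul _)
  · exact f.hasCompactSupport.comp_smul (inv_ne_zero hR.ne')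
  · intro x hx
    apply f.one_of_mem_closedBall
    rw [mem_ball_zero_iff] at hx
    rw [mem_closedBall_zero_iff, norm_smul, norm_inv, Real.norm_of_nonneg hR.le]
    show R⁻¹ * ‖x‖ ≤ 1
    rw [inv_mul_le_iff₀ hR]; linarith
  · intro x hx
    have : (fun x => f (R⁻¹ • x)) =ᶠ[nhds x] fun _ => 1 := by
      filter_upwards [isOpen_ball.mem_nhds hx] with y hy
      apply f.one_of_mem_closedBall
      rw [mem_ball_zero_iff] at hy
      rw [mem_closedBall_zero_iff, norm_smul, norm_inv, Real.norm_of_nonneg hR.le]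
      show R⁻¹ * ‖y‖ ≤ 1
      rw [inv_mul_le_iff₀ hR]; linarith
    rw [this.fderiv_eq]; simp
  · intro x hx
    apply f.zero_of_le_dist
    rw [mem_ball_zero_iff, not_lt] at hx
    rw [dist_zero_right, norm_smul, norm_inv, Real.norm_of_nonneg hR.le]
    show 2 ≤ R⁻¹ * ‖x‖
    rw [le_inv_mul_iff₀ hR]; linarith
  · intro x
    rw [fderiv_comp_smul, norm_smul, norm_inv, Real.norm_of_nonneg hR.le, div_eq_inv_mul]
    gcongr
    exact hK _

lemma lv_young {w q p s η d n D k ε : ℝ} (hq : 0 ≤ q) (hq1 : q ≤ 1) (hp : 0 ≤ p)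
    (hs : 0 ≤ s) (hps : p ≤ s * q) (hη : 0 ≤ η) (hn : 0 ≤ n) (hD : |D| ≤ d * n) (hd0 : 0 ≤ d)
    (hd : d ≤ k) (hε : 0 < ε) :
    w ^ 2 * q * n ^ 2 * η ^ 2 - ε * (w ^ 2 * q * n ^ 2 * η ^ 2) - k ^ 2 / ε * (w * s) ^ 2 ≤
      w ^ 2 * (q * η ^ 2 * n ^ 2 + 2 * p * η * D) := by
  have hk : 0 ≤ k := hd0.trans hd
  have h1 : -(2 * p * η * D) ≤ 2 * (s * q) * η * (k * n) := by
    have hD' : -D ≤ k * n := by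
      have := neg_abs_le D
      nlinarith
    calc -(2 * p * η * D) = 2 * p * η * (-D) := by ring
      _ ≤ 2 * p * η * (k * n) := by gcongr
      _ ≤ _ := by gcongr
  have h2 : 2 * s * η * (k * n) ≤ ε * η ^ 2 * n ^ 2 + k ^ 2 / ε * s ^ 2 := by
    have : ε * η ^ 2 * n ^ 2 + k ^ 2 / ε * s ^ 2 - 2 * s * η * (k * n)
        = (ε * η * n - k * s) ^ 2 / ε := by field_simp; ring
    have h3 : 0 ≤ (ε * η * n - k * s) ^ 2 / ε := by positivity
    linarith
  have h3 : 2 * (s * q) * η * (k * n) ≤ ε * (q * n ^ 2 * η ^ 2) + k ^ 2 / ε * s ^ 2 := by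
    have a1 := mul_le_mul_of_nonneg_left h2 hq
    have a2 : q * (k ^ 2 / ε * s ^ 2) ≤ 1 * (k ^ 2 / ε * s ^ 2) := by gcongr
    nlinarith
  have h4 := mul_le_mul_of_nonneg_left (h1.trans h3) (sq_nonneg w)
  nlinarith

lemma lv_grad_contDiff {N : ℕ} {σ : EuclideanSpace ℝ (Fin N) → ℝ} (hσ : ContDiff ℝ 2 σ) :
    ContDiff ℝ 1 (gradient σ) := by
  have h : ContDiff ℝ 1 (fderiv ℝ σ) := hσ.fderiv_right (by norm_num)
  exact (InnerProductSpace.toDual ℝ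
    (EuclideanSpace ℝ (Fin N))).symm.toContinuousLinearEquiv.contDiff.comp h

lemma lv_energy {N : ℕ} (v σ η : EuclideanSpace ℝ (Fin N) → ℝ)
    (hv : ContDiff ℝ 2 v) (hσ : ContDiff ℝ 2 σ)
    (hineq : ∀ x, 0 ≤ dvg (fun y => (v y) ^ 2 • gradient σ y) x)
    (hη : ContDiff ℝ 1 η) (hc : HasCompactSupport η) (h0 : ∀ x, 0 ≤ η x)
    (R k ε : ℝ) (hR : 0 < R) (hε : 0 < ε)
    (hin : ∀ x ∈ ball 0 R, η x = 1) (hin' : ∀ x ∈ ball 0 R, fderiv ℝ η x = 0)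
    (hout : ∀ x ∉ ball 0 (2 * R), η x = 0) (hk : ∀ x, ‖fderiv ℝ η x‖ ≤ k) :
    ∫ x, v x ^ 2 * lvq (σ x) * ‖gradient σ x‖ ^ 2 * η x ^ 2 ≤
      ε * ((∫ x, v x ^ 2 * lvq (σ x) * ‖gradient σ x‖ ^ 2 * η x ^ 2)
        - ∫ x in ball 0 R, v x ^ 2 * lvq (σ x) * ‖gradient σ x‖ ^ 2)
      + k ^ 2 / ε * ∫ x in ball 0 (2 * R), (v x * max (σ x) 0) ^ 2 := by
  have hg := lv_grad_contDiff hσ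
  have hgc := hg.continuous
  have hvc := hv.continuous
  have hσc := hσ.continuous
  have hηc := hη.continuous
  have hηf : Continuous (fderiv ℝ η) := hη.continuous_fderiv (by norm_num)
  have hv1 : ContDiff ℝ 1 v := hv.of_le (by norm_num)
  have hσ1 : ContDiff ℝ 1 σ := hσ.of_le (by norm_num)
  have hpσ : ContDiff ℝ 1 (fun x => lvp (σ x)) := lvp_contDiff.comp hσ1
  set F : EuclideanSpace ℝ (Fin N) → EuclideanSpace ℝ (Fin N) :=
    fun y => (v y) ^ 2 • gradient σ y with hF
  have hF1 : ContDiff ℝ 1 F := (hv1.pow 2).smul hg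
  set φ : EuclideanSpace ℝ (Fin N) → ℝ := fun x => lvp (σ x) * η x ^ 2 with hφ
  have hφ1 : ContDiff ℝ 1 φ := hpσ.mul (hη.pow 2)
  have hη2c : HasCompactSupport (fun x => η x ^ 2) := by
    refine hc.mono fun x hx => ?_
    simpa using hx
  have hφc : HasCompactSupport φ := hη2c.mul_left
  have hparts := lv_parts φ F hφ1 hφc hF1
  have hpos : 0 ≤ ∫ x, φ x * dvg F x := integral_nonneg fun x =>
    mul_nonneg (mul_nonneg (lvp_nonneg _) (sq_nonneg _)) (hineq x)
  have hfd : ∀ x, fderiv ℝ φ x (F x) = v x ^ 2 * (lvq (σ x) * η x ^ 2 * ‖gradient σ x‖ ^ 2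
      + 2 * lvp (σ x) * η x * fderiv ℝ η x (gradient σ x)) := by
    intro x
    have d1 : HasFDerivAt σ (fderiv ℝ σ x) x := (hσ1.differentiable (by norm_num) x).hasFDerivAt
    have d2 : HasFDerivAt η (fderiv ℝ η x) x := (hη.differentiable (by norm_num) x).hasFDerivAt
    have d3 := (lvp_hasDerivAt (σ x)).comp_hasFDerivAt x d1
    have d4 := d3.mul (d2.pow 2)
    have hgg : fderiv ℝ σ x (gradient σ x) = ‖gradient σ x‖ ^ 2 := by
      rw [← real_inner_self_eq_norm_sq]
      conv_rhs => rw [gradient]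
      rw [InnerProductSpace.toDual_symm_apply]
      rfl
    have d5 : fderiv ℝ φ x = _ := d4.fderiv
    rw [d5]
    simp only [hF, hgg, map_smul, ContinuousLinearMap.add_apply, ContinuousLinearMap.smul_apply,
      smul_eq_mul, Function.comp_apply, nsmul_eq_mul, Nat.cast_ofNat, Nat.add_one_sub_one, pow_one]
    ring
  have hfdi : Integrable (fun x => fderiv ℝ φ x (F x)) := by
    apply Continuous.integrable_of_hasCompactSupport
    · exact (hφ1.continuous_fderiv (by norm_num)).clm_apply hF1.continuous
    · refine (hφc.fderiv (𝕜 := ℝ)).mono ?_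
      intro x hx
      simp only [Function.mem_support] at hx ⊢
      intro h; apply hx; rw [h]; rfl
  set G : EuclideanSpace ℝ (Fin N) → ℝ :=
    fun x => v x ^ 2 * lvq (σ x) * ‖gradient σ x‖ ^ 2 with hG
  have hqc := lvq_cont
  have hGc : Continuous G := by fun_prop
  have hGi : Integrable (fun x => G x * η x ^ 2) :=
    (hGc.mul (hηc.pow 2)).integrable_of_hasCompactSupport hη2c.mul_left
  have hGB : Integrable ((ball 0 R).indicator G) := by
    rw [integrable_indicator_iff measurableSet_ball]
    exact (hGc.locallyIntegrable.integrableOn_isCompact (isCompact_closedBall 0 R)).mono_set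
      ball_subset_closedBall
  set S : EuclideanSpace ℝ (Fin N) → ℝ := fun x => (v x * max (σ x) 0) ^ 2 with hS
  have hSc : Continuous S := by fun_prop
  have hSB : Integrable ((ball 0 (2 * R)).indicator S) := by
    rw [integrable_indicator_iff measurableSet_ball]
    exact (hSc.locallyIntegrable.integrableOn_isCompact (isCompact_closedBall 0 (2 * R))).mono_set
      ball_subset_closedBall
  have hpt : ∀ x, G x * η x ^ 2 - ε * (G x * η x ^ 2 - (ball 0 R).indicator G x)
      - k ^ 2 / ε * (ball 0 (2 * R)).indicator S x ≤ fderiv ℝ φ x (F x) := by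
    intro x
    rw [hfd]
    by_cases hx : x ∈ ball 0 R
    · have hx2 : x ∈ ball (0 : EuclideanSpace ℝ (Fin N)) (2 * R) :=
        ball_subset_ball (by linarith) hx
      rw [Set.indicator_of_mem hx, Set.indicator_of_mem hx2, hin x hx, hin' x hx]
      have : 0 ≤ k ^ 2 / ε * S x := by positivity
      simp [hG] at this ⊢
      nlinarith
    · rw [Set.indicator_of_notMem hx]
      by_cases hx2 : x ∈ ball (0 : EuclideanSpace ℝ (Fin N)) (2 * R)
      · rw [Set.indicator_of_mem hx2, sub_zero]
        exact lv_young (lvq_nonneg _) (lvq_le_one _) (lvp_nonneg _) (le_max_right _ _)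
          (lvp_le _) (h0 x) (norm_nonneg _)
          ((fderiv ℝ η x).le_opNorm (gradient σ x)) (norm_nonneg _) (hk x) hε
      · rw [Set.indicator_of_notMem hx2, hout x hx2]
        simp
  have j1 : Integrable (fun x => ε * (G x * η x ^ 2 - (ball 0 R).indicator G x)) :=
    (hGi.sub hGB).const_mul ε
  have j2 : Integrable (fun x => G x * η x ^ 2
      - ε * (G x * η x ^ 2 - (ball 0 R).indicator G x)) := hGi.sub j1
  have j3 : Integrable (fun x => k ^ 2 / ε * (ball 0 (2 * R)).indicator S x) :=
    hSB.const_mul (k ^ 2 / ε)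
  have hint := integral_mono (j2.sub j3) hfdi hpt
  simp only [Pi.sub_apply] at hint
  rw [integral_sub j2 j3, integral_sub hGi j1, integral_const_mul, integral_const_mul,
    integral_sub hGi hGB, integral_indicator measurableSet_ball,
    integral_indicator measurableSet_ball] at hint
  linarith

/-- **Proposition 2.2 (a Liouville-type theorem).** If `v, σ ∈ C²(ℝᴺ)`, `v > 0`,
`-div(v² ∇σ) ≤ 0` on `ℝᴺ`, and `∫_{B_R(0)} (v σ⁺)² ≤ C R²` for all large `R`,
then `σ⁺` is constant. -/
theorem liouville_type_theorem
    (N : ℕ) (hN : 1 ≤ N) (v σ : EuclideanSpace ℝ (Fin N) → ℝ)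
    (hv : ContDiff ℝ 2 v) (hσ : ContDiff ℝ 2 σ)
    (hvpos : ∀ x, 0 < v x)
    (hineq : ∀ x, 0 ≤ dvg (fun y => (v y) ^ 2 • gradient σ y) x)
    (C : ℝ) (hC : 0 < C)
    (hbound : ∀ᶠ R in atTop,
      ∫ x in ball (0 : EuclideanSpace ℝ (Fin N)) R, (v x * max (σ x) 0) ^ 2 ≤ C * R ^ 2) :
    ∃ c : ℝ, ∀ x, max (σ x) 0 = c := by
  obtain ⟨K, hK⟩ := lv_cutoff N
  obtain ⟨R1, hR1⟩ := eventually_atTop.1 hbound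
  have hgc := (lv_grad_contDiff hσ).continuous
  have hvc := hv.continuous
  have hσc := hσ.continuous
  have hqc := lvq_cont
  set G : EuclideanSpace ℝ (Fin N) → ℝ :=
    fun x => v x ^ 2 * lvq (σ x) * ‖gradient σ x‖ ^ 2 with hG
  have hGc : Continuous G := by fun_prop
  have hG0 : ∀ x, 0 ≤ G x := fun x =>
    mul_nonneg (mul_nonneg (sq_nonneg _) (lvq_nonneg _)) (sq_nonneg _)
  have hGB : ∀ R, IntegrableOn G (ball 0 R) := fun R =>
    (hGc.locallyIntegrable.integrableOn_isCompact (isCompact_closedBall 0 R)).mono_set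
      ball_subset_closedBall
  set a : ℝ → ℝ := fun R => ∫ x in ball 0 R, G x with ha
  have hmono : Monotone a := fun R R' h =>
    setIntegral_mono_set (hGB R') (Eventually.of_forall hG0)
      (ball_subset_ball h).eventuallyLE
  set M : ℝ := 4 * C * K ^ 2 with hM
  have hM0 : 0 ≤ M := by positivity
  have hcmp : ∀ R, 0 < R → ∀ η : EuclideanSpace ℝ (Fin N) → ℝ,
      Continuous η → HasCompactSupport η → (∀ x, 0 ≤ η x) → (∀ x, η x ≤ 1) →
      (∀ x ∈ ball 0 R, η x = 1) → (∀ x ∉ ball 0 (2 * R), η x = 0) →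
      Integrable (fun x => G x * η x ^ 2) ∧
      a R ≤ ∫ x, G x * η x ^ 2 ∧ ∫ x, G x * η x ^ 2 ≤ a (2 * R) := by
    intro R hR η hηc hc h0 h1 hin hout
    have hη2c : HasCompactSupport (fun x => η x ^ 2) := by
      refine hc.mono fun x hx => ?_
      simpa using hx
    have hGi : Integrable (fun x => G x * η x ^ 2) :=
      (hGc.mul (hηc.pow 2)).integrable_of_hasCompactSupport hη2c.mul_left
    refine ⟨hGi, ?_, ?_⟩
    · simp only [ha]
      rw [← integral_indicator measurableSet_ball]
      refine integral_mono ((integrable_indicator_iff measurableSet_ball).2 (hGB R)) hGi ?_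
      intro x
      by_cases hx : x ∈ ball 0 R
      · simp [Set.indicator_of_mem hx, hin x hx]
      · rw [Set.indicator_of_notMem hx]
        exact mul_nonneg (hG0 x) (sq_nonneg _)
    · simp only [ha]
      rw [← integral_indicator measurableSet_ball]
      refine integral_mono hGi ((integrable_indicator_iff measurableSet_ball).2 (hGB _)) ?_
      intro x
      by_cases hx : x ∈ ball 0 (2 * R)
      · rw [Set.indicator_of_mem hx]
        exact mul_le_of_le_one_right (hG0 x) (pow_le_one₀ (h0 x) (h1 x))
      · simp [Set.indicator_of_notMem hx, hout x hx]
  have hest : ∀ R ≥ max R1 1, ∀ ε > 0, ∃ A, a R ≤ A ∧ A ≤ a (2 * R) ∧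
      A ≤ ε * (A - a R) + M / ε := by
    intro R hR ε hε
    have hR1' : R1 ≤ R := (le_max_left _ _).trans hR
    have hRpos : 0 < R := lt_of_lt_of_le one_pos ((le_max_right _ _).trans hR)
    obtain ⟨η, k1, k2, k3, k4, k5, k6, k7, k8⟩ := hK R hRpos
    obtain ⟨_, c1, c2⟩ := hcmp R hRpos η k1.continuous k2 k3 k4 k5 k7
    refine ⟨_, c1, c2, ?_⟩
    have e := lv_energy v σ η hv hσ hineq k1 k2 k3 R (K / R) ε hRpos hε k5 k6 k7 k8
    refine e.trans ?_
    have hb := hR1 (2 * R) (by linarith)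
    have : (K / R) ^ 2 / ε * ∫ x in ball (0 : EuclideanSpace ℝ (Fin N)) (2 * R),
        (v x * max (σ x) 0) ^ 2 ≤ M / ε := by
      calc _ ≤ (K / R) ^ 2 / ε * (C * (2 * R) ^ 2) := by gcongr
        _ = M / ε := by rw [hM]; field_simp; ring
    simp only [ha]
    linarith
  have ha0 : ∀ R, 0 ≤ a R := fun R => integral_nonneg hG0
  have hzero := lv_growth a M (max R1 1) hM0 hmono
    (fun R hR => by
      obtain ⟨A, h1, h2, h3⟩ := hest R hR (1/2) (by norm_num)
      have := ha0 R
      have e : M / (1/2) = 2 * M := by ring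
      linarith)
    (fun R hR ε hε => by
      obtain ⟨A, h1, h2, h3⟩ := hest R hR ε hε
      have : ε * (A - a R) ≤ ε * (a (2 * R) - a R) := by gcongr
      linarith)
  have hGz : ∀ x, G x = 0 := by
    intro x
    have hRpos : 0 < ‖x‖ + 1 := by positivity
    obtain ⟨η, k1, k2, k3, k4, k5, k6, k7, k8⟩ := hK (‖x‖ + 1) hRpos
    obtain ⟨hi, c1, c2⟩ := hcmp _ hRpos η k1.continuous k2 k3 k4 k5 k7
    have hz : ∫ x, G x * η x ^ 2 = 0 :=
      le_antisymm (c2.trans (hzero _)) ((ha0 _).trans c1)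
    rw [integral_eq_zero_iff_of_nonneg (fun x => mul_nonneg (hG0 x) (sq_nonneg _)) hi] at hz
    have hz' := (Continuous.ae_eq_iff_eq (μ := volume) (hGc.mul (k1.continuous.pow 2))
      continuous_zero).1 hz
    have := congrFun hz' x
    simpa [k5 x (by simp)] using this
  have hconst : ∀ x y, lvp (σ x) = lvp (σ y) := by
    have hσ1 : Differentiable ℝ σ := hσ.differentiable (by norm_num)
    refine is_const_of_fderiv_eq_zero (𝕜 := ℝ) (f := fun x => lvp (σ x))
      (fun x => ((lvp_hasDerivAt (σ x)).comp_hasFDerivAt x (hσ1 x).hasFDerivAt).differentiableAt) ?_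
    intro x
    have d : fderiv ℝ (fun x => lvp (σ x)) x = _ :=
      ((lvp_hasDerivAt (σ x)).comp_hasFDerivAt x (hσ1 x).hasFDerivAt).fderiv
    rw [d]
    have := hGz x
    simp only [hG, mul_eq_zero, pow_eq_zero_iff (two_ne_zero), (hvpos x).ne', false_or,
      norm_eq_zero] at this
    rcases this with h | h
    · rw [h, zero_smul]
    · rw [gradient, map_eq_zero_iff _ (LinearIsometryEquiv.injective _)] at h
      rw [h, smul_zero]
  refine ⟨max (σ 0) 0, fun x => ?_⟩
  apply lvp_strictMonoOn.injOn (Set.mem_Ici.2 (le_max_right _ _)) (Set.mem_Ici.2 (le_max_right _ _))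
  rw [lvp_max, lvp_max]
  exact hconst x 0
end
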